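/- Let $u_0,\ldots,u_n$ ($n\ge 2$) be real numbers, not all zero. Let $\pi$ be a uniform random permutation of $\{0,1,\ldots,n\}$ and let $P(x)=\sum_{k=0}^n u_{\pi(k)} x^k$. Then the expected number of real zeroes of $P$ in $\mathbb{R}\setminus\{0\}$, counted with multiplicity, is at most $C\log n$ for some absolute constant $C$. -/

import Mathlib

open Finset Polynomial

/-- uniform average over a finite type -/
noncomputable def Ex {α : Type*} [Fintype α] (f : α → ℝ) : ℝ := (∑ x, f x) / (Fintype.card α : ℝ)

section ExAPI
variable {α : Type*} [Fintype α] 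

lemma Ex_add (f g : α → ℝ) : Ex (fun x => f x + g x) = Ex f + Ex g := by
  simp [Ex, Finset.sum_add_distrib, add_div]

lemma Ex_sub (f g : α → ℝ) : Ex (fun x => f x - g x) = Ex f - Ex g := by
  simp [Ex, Finset.sum_sub_distrib, sub_div]

lemma Ex_mul_left (c : ℝ) (f : α → ℝ) : Ex (fun x => c * f x) = c * Ex f := by
  simp [Ex, ← Finset.mul_sum, mul_div_assoc]

lemma Ex_mul_right (c : ℝ) (f : α → ℝ) : Ex (fun x => f x * c) = Ex f * c := by
  simp [Ex, ← Finset.sum_mul, div_mul_eq_mul_div]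

lemma Ex_neg (f : α → ℝ) : Ex (fun x => - f x) = - Ex f := by
  simp [Ex, neg_div]

lemma Ex_sum {ι : Type*} (s : Finset ι) (f : ι → α → ℝ) :
    Ex (fun x => ∑ i ∈ s, f i x) = ∑ i ∈ s, Ex (f i) := by
  simp only [Ex, Finset.sum_div]
  rw [Finset.sum_comm]

lemma Ex_mono {f g : α → ℝ} (h : ∀ x, f x ≤ g x) : Ex f ≤ Ex g := by
  unfold Ex
  gcongr with x
  exact h x

lemma Ex_nonneg {f : α → ℝ} (h : ∀ x, 0 ≤ f x) : 0 ≤ Ex f := by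
  unfold Ex
  exact div_nonneg (Finset.sum_nonneg fun x _ => h x) (by positivity)

lemma Ex_const [Nonempty α] (c : ℝ) : Ex (fun _ : α => c) = c := by
  have : (Fintype.card α : ℝ) ≠ 0 := by exact_mod_cast Fintype.card_ne_zero
  simp [Ex, mul_comm]

lemma Ex_equiv {β : Type*} [Fintype β] (e : α ≃ β) (f : β → ℝ) : Ex (fun x => f (e x)) = Ex f := by
  unfold Ex
  rw [Fintype.card_congr e, Equiv.sum_comp e f]

lemma Ex_mulRight {G : Type*} [Group G] [Fintype G] (g : G) (f : G → ℝ) :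
    Ex (fun x => f (x * g)) = Ex f := Ex_equiv (Equiv.mulRight g) f

lemma Ex_cs (f g : α → ℝ) : (Ex fun x => f x * g x) ^ 2 ≤ Ex (fun x => f x ^ 2) * Ex (fun x => g x ^ 2) := by
  unfold Ex
  rw [div_pow, div_mul_div_comm, ← sq]
  gcongr
  exact Finset.sum_mul_sq_le_sq_mul_sq _ _ _

lemma Ex_comm {β : Type*} [Fintype β] (f : α → β → ℝ) :
    Ex (fun x => Ex (fun y => f x y)) = Ex (fun y => Ex (fun x => f x y)) := by
  unfold Ex
  simp only [← Finset.sum_div]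
  rw [Finset.sum_comm, div_div, div_div, mul_comm]

/-- if `ind ≥ 0` is an indicator-like weight with `Ex (ind * Z^2) ≤ B^2 * Ex ind` then
 `Ex (ind * |Z|) ≤ B * Ex ind`. -/
lemma Ex_abs_le {ind Z : α → ℝ} (h0 : ∀ x, 0 ≤ ind x) {B : ℝ} (hB : 0 < B)
    (h : Ex (fun x => ind x * Z x ^ 2) ≤ B ^ 2 * Ex ind) :
    Ex (fun x => ind x * |Z x|) ≤ B * Ex ind := by
  have h1 : ∀ x, ind x * |Z x| ≤ (1 / (2 * B)) * (ind x * Z x ^ 2) + (B / 2) * ind x := by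
    intro x
    have : |Z x| ≤ (1 / (2 * B)) * Z x ^ 2 + B / 2 := by
      rw [← sq_abs]
      have := sq_nonneg (|Z x| - B)
      have h2 : (1 / (2 * B)) * |Z x| ^ 2 + B / 2 = (|Z x|^2 + B^2) / (2 * B) := by
        field_simp
      rw [h2, le_div_iff₀ (by positivity)]
      nlinarith
    nlinarith [mul_le_mul_of_nonneg_left this (h0 x)]
  have h2 := Ex_mono h1
  rw [Ex_add, Ex_mul_left, Ex_mul_left] at h2
  have h3 : (1 / (2 * B)) * Ex (fun x => ind x * Z x ^ 2) ≤ (1 / (2 * B)) * (B ^ 2 * Ex ind) := by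
    gcongr
  have h4 : (1 / (2 * B)) * (B ^ 2 * Ex ind) = B / 2 * Ex ind := by field_simp
  linarith

/-- indicator -/
noncomputable def ind (p : Prop) : ℝ := by
  classical exact if p then 1 else 0

lemma ind_true {p : Prop} (h : p) : ind p = 1 := by simp [ind, h]
lemma ind_false {p : Prop} (h : ¬ p) : ind p = 0 := by simp [ind, h]
lemma ind_nonneg (p : Prop) : 0 ≤ ind p := by
  by_cases h : p
  · simp [ind_true h]
  · simp [ind_false h]
lemma ind_le_one (p : Prop) : ind p ≤ 1 := by
  by_cases h : p
  · simp [ind_true h]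
  · simp [ind_false h]
lemma ind_mono {p q : Prop} (h : p → q) : ind p ≤ ind q := by
  by_cases hp : p
  · rw [ind_true hp, ind_true (h hp)]
  · rw [ind_false hp]; exact ind_nonneg q
lemma ind_congr {p q : Prop} (h : p ↔ q) : ind p = ind q := by
  rw [propext h]

/-- Markov -/
lemma Ex_ind_le {Z : α → ℝ} (h0 : ∀ x, 0 ≤ Z x) {t : ℝ} (ht : 0 < t) :
    Ex (fun x => ind (t ≤ Z x)) ≤ Ex Z / t := by
  rw [le_div_iff₀ ht, ← Ex_mul_right]
  apply Ex_mono
  intro x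
  by_cases h : t ≤ Z x
  · rw [ind_true h]; linarith
  · rw [ind_false h]; simpa using h0 x

end ExAPI

section exch
variable {ι : Type*} [Fintype ι] [DecidableEq ι]

lemma Ex_tuple {k : ℕ} (H : (Fin k → ι) → ℝ) (e e' : Fin k ↪ ι) :
    Ex (fun σ : Equiv.Perm ι => H (fun i => σ (e i))) = Ex (fun σ : Equiv.Perm ι => H (fun i => σ (e' i))) := by
  have := Equiv.Perm.isMultiplyPretransitive ι k
  obtain ⟨g, hg⟩ := this.exists_smul_eq e e'
  rw [← Ex_mulRight g]
  congr 1
  ext σ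
  congr 1
  ext i
  have : e' i = g (e i) := by rw [← hg]; rfl
  rw [this]
  rfl

/-- exchangeable second moments over a set `E` -/
lemma exch_moment (v : ι → ℝ) (J : Equiv.Perm ι → ℝ) (hJ : ∀ σ, 0 ≤ J σ) (E : Finset ι)
    (hE : E.Nonempty)
    (hinv : ∀ σ, ∀ i ∈ E, ∀ j ∈ E, J (σ * Equiv.swap i j) = J σ) :
    ∃ a b : ℝ, 0 ≤ a ∧ |b| ≤ a ∧ (E.card : ℝ) * a ≤ (∑ i, v i ^ 2) * Ex J ∧
      (∀ i ∈ E, Ex (fun σ => J σ * v (σ i) ^ 2) = a) ∧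
      (∀ i ∈ E, ∀ j ∈ E, i ≠ j → Ex (fun σ => J σ * (v (σ i) * v (σ j))) = b) ∧
      (∀ D ⊆ E, ∀ w : ι → ℝ, Ex (fun σ => J σ * (∑ i ∈ D, w i * v (σ i)) ^ 2) =
        a * (∑ i ∈ D, w i ^ 2) + b * ((∑ i ∈ D, w i) ^ 2 - ∑ i ∈ D, w i ^ 2)) := by
  classical
  have key : ∀ (H : Equiv.Perm ι → ℝ) (i j : ι), i ∈ E → j ∈ E →
      Ex (fun σ => J σ * H (σ * Equiv.swap i j)) = Ex (fun σ => J σ * H σ) := by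
    intro H i j hi hj
    rw [← Ex_mulRight (Equiv.swap i j) (fun σ => J σ * H σ)]
    congr 1; ext σ; rw [hinv σ i hi j hj]
  have key1 : ∀ i ∈ E, ∀ j ∈ E, Ex (fun σ => J σ * v (σ i) ^ 2) = Ex (fun σ => J σ * v (σ j) ^ 2) := by
    intro i hi j hj
    rw [← key (fun σ => v (σ i) ^ 2) i j hi hj]
    congr 1; ext σ; simp
  have key2 : ∀ i ∈ E, ∀ j ∈ E, ∀ i' ∈ E, i ≠ j → i' ≠ j →
      Ex (fun σ => J σ * (v (σ i) * v (σ j))) = Ex (fun σ => J σ * (v (σ i') * v (σ j))) := by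
    intro i hi j hj i' hi' h1 h2
    rw [← key (fun σ => v (σ i) * v (σ j)) i i' hi hi']
    congr 1; ext σ
    simp [Equiv.swap_apply_of_ne_of_ne h1.symm h2.symm]
  have sym : ∀ i j, Ex (fun σ => J σ * (v (σ i) * v (σ j))) = Ex (fun σ => J σ * (v (σ j) * v (σ i))) := by
    intro i j; congr 1; ext σ; ring
  have key3 : ∀ i ∈ E, ∀ j ∈ E, ∀ i' ∈ E, ∀ j' ∈ E, i ≠ j → i' ≠ j' →
      Ex (fun σ => J σ * (v (σ i) * v (σ j))) = Ex (fun σ => J σ * (v (σ i') * v (σ j'))) := by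
    intro i hi j hj i' hi' j' hj' h1 h2
    by_cases h : i' = j
    · subst h
      rw [sym i i', sym i' i, key2 i hi i' hj j' hj' h1 (Ne.symm h2), sym]
    · rw [key2 i hi j hj i' hi' h1 h, sym i' j, key2 j hj i' hi' j' hj' (Ne.symm h) (Ne.symm h2), sym]
  obtain ⟨i0, hi0⟩ := hE
  set a := Ex (fun σ => J σ * v (σ i0) ^ 2) with ha
  have ha0 : 0 ≤ a := Ex_nonneg fun σ => mul_nonneg (hJ σ) (sq_nonneg _)
  have hb : ∃ b : ℝ, |b| ≤ a ∧ ∀ i ∈ E, ∀ j ∈ E, i ≠ j → Ex (fun σ => J σ * (v (σ i) * v (σ j))) = b := by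
    by_cases hex : ∃ i ∈ E, ∃ j ∈ E, i ≠ j
    · obtain ⟨i, hi, j, hj, hij⟩ := hex
      refine ⟨Ex (fun σ => J σ * (v (σ i) * v (σ j))), ?_, fun i' hi' j' hj' h => key3 _ hi' _ hj' _ hi _ hj h hij⟩
      have e1 := key1 i hi i0 hi0
      have e2 := key1 j hj i0 hi0
      rw [abs_le]
      constructor
      · have : Ex (fun σ => (-(1/2)) * (J σ * v (σ i) ^ 2) + (-(1/2)) * (J σ * v (σ j) ^ 2)) ≤ Ex (fun σ => J σ * (v (σ i) * v (σ j))) := by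
          apply Ex_mono; intro σ
          nlinarith [mul_nonneg (hJ σ) (sq_nonneg (v (σ i) + v (σ j)))]
        rw [Ex_add, Ex_mul_left, Ex_mul_left, e1, e2] at this
        linarith
      · have : Ex (fun σ => J σ * (v (σ i) * v (σ j))) ≤ Ex (fun σ => ((1/2)) * (J σ * v (σ i) ^ 2) + ((1/2)) * (J σ * v (σ j) ^ 2)) := by
          apply Ex_mono; intro σ
          nlinarith [mul_nonneg (hJ σ) (sq_nonneg (v (σ i) - v (σ j)))]
        rw [Ex_add, Ex_mul_left, Ex_mul_left, e1, e2] at this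
        linarith
    · exact ⟨0, by simpa using ha0, fun i hi j hj h => absurd ⟨i, hi, j, hj, h⟩ hex⟩
  obtain ⟨b, hb1, hb2⟩ := hb
  refine ⟨a, b, ha0, hb1, ?_, fun i hi => key1 i hi i0 hi0, hb2, ?_⟩
  · have : (E.card : ℝ) * a = ∑ i ∈ E, Ex (fun σ => J σ * v (σ i) ^ 2) := by
      rw [Finset.sum_congr rfl fun i hi => key1 i hi i0 hi0]; simp [ha]
    rw [this, ← Ex_sum, ← Ex_mul_left]
    apply Ex_mono; intro σ
    rw [← Finset.mul_sum, mul_comm]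
    apply mul_le_mul_of_nonneg_right _ (hJ σ)
    rw [← Equiv.sum_comp σ (fun i => v i ^ 2)]
    exact Finset.sum_le_sum_of_subset_of_nonneg (Finset.subset_univ _) fun _ _ _ => sq_nonneg _
  · intro D hD w
    have e1 : (fun σ : Equiv.Perm ι => J σ * (∑ i ∈ D, w i * v (σ i)) ^ 2) =
        fun σ => ∑ i ∈ D, ∑ j ∈ D, (w i * w j) * (J σ * (v (σ i) * v (σ j))) := by
      ext σ
      rw [sq, Finset.sum_mul_sum, Finset.mul_sum]
      refine Finset.sum_congr rfl fun i _ => ?_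
      rw [Finset.mul_sum]
      refine Finset.sum_congr rfl fun j _ => ?_
      ring
    rw [e1, Ex_sum]
    have e2 : ∀ i ∈ D, Ex (fun σ => ∑ j ∈ D, (w i * w j) * (J σ * (v (σ i) * v (σ j)))) =
        w i ^ 2 * (a - b) + b * (w i * ∑ j ∈ D, w j) := by
      intro i hi
      rw [Ex_sum]
      have : ∀ j ∈ D, Ex (fun σ => (w i * w j) * (J σ * (v (σ i) * v (σ j)))) =
          (if j = i then w i ^ 2 * (a - b) else 0) + b * (w i * w j) := by
        intro j hj
        rw [Ex_mul_left]
        split_ifs with h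
        · subst h
          have := key1 j (hD hj) i0 hi0
          simp only [sq] at this ⊢
          rw [this, ha]; simp only [sq]; ring
        · rw [hb2 i (hD hi) j (hD hj) (Ne.symm h)]; ring
      rw [Finset.sum_congr rfl this, Finset.sum_add_distrib, Finset.sum_ite_eq' D i, if_pos hi,
        ← Finset.mul_sum, ← Finset.mul_sum]
    rw [Finset.sum_congr rfl e2, Finset.sum_add_distrib, ← Finset.sum_mul, ← Finset.mul_sum, ← Finset.sum_mul]
    ring

/-- moments for centred values, over the full symmetric group -/
lemma full_moment (v : ι → ℝ) (hv : ∑ i, v i = 0) (hN : 2 ≤ Fintype.card ι) (D : Finset ι) (w : ι → ℝ) :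
    Ex (fun σ : Equiv.Perm ι => (∑ i ∈ D, w i * v (σ i)) ^ 2) =
     (∑ i, v i ^ 2) / Fintype.card ι * ((∑ i ∈ D, w i ^ 2) - ((∑ i ∈ D, w i) ^ 2 - ∑ i ∈ D, w i ^ 2) / (Fintype.card ι - 1)) := by
  classical
  have hne : (Finset.univ : Finset ι).Nonempty := by
    rw [← Finset.card_pos, Finset.card_univ]; omega
  obtain ⟨a, b, -, -, -, ha, hb, h⟩ := exch_moment v (fun _ => 1) (fun _ => by norm_num) Finset.univ hne
    (fun _ _ _ _ _ => rfl)
  have hN' : (2:ℝ) ≤ Fintype.card ι := by exact_mod_cast hN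
  have h1 : (Fintype.card ι : ℝ) * a = ∑ i, v i ^ 2 := by
    have : (Fintype.card ι : ℝ) * a = ∑ i : ι, Ex (fun σ : Equiv.Perm ι => 1 * v (σ i) ^ 2) := by
      rw [Finset.sum_congr rfl fun i hi => ha i hi]; simp
    rw [this, ← Ex_sum]
    simp only [one_mul]
    have : ∀ σ : Equiv.Perm ι, ∑ i, v (σ i) ^ 2 = ∑ i, v i ^ 2 := fun σ => Equiv.sum_comp σ (fun i => v i ^ 2)
    simp only [this]
    exact Ex_const _
  have h2 := h Finset.univ (le_refl _) (fun _ => 1)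
  have h3 : ∀ σ : Equiv.Perm ι, ∑ i, 1 * v (σ i) = 0 := by
    intro σ; simp only [one_mul]; rw [Equiv.sum_comp σ v, hv]
  simp only [h3] at h2
  rw [show (fun σ : Equiv.Perm ι => (1:ℝ) * 0 ^ 2) = fun _ => 0 by ext; simp, Ex_const] at h2
  simp only [Finset.sum_const, Finset.card_univ, nsmul_eq_mul, one_pow, mul_one] at h2
  have h4 := h D (Finset.subset_univ _) w
  simp only [one_mul] at h4
  rw [h4]
  have hb' : b = - a / (Fintype.card ι - 1) := by
    have : (Fintype.card ι : ℝ) - 1 ≠ 0 := by linarith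
    have h0 : (Fintype.card ι : ℝ) ≠ 0 := by linarith
    field_simp
    have : (Fintype.card ι : ℝ) * (a + b * (Fintype.card ι - 1)) = 0 := by linarith
    rcases mul_eq_zero.1 this with h | h
    · exact absurd h h0
    · linarith
  rw [hb', ← h1]
  have h0 : (Fintype.card ι : ℝ) ≠ 0 := by linarith
  field_simp
  ring

lemma full_moment_le (v : ι → ℝ) (hv : ∑ i, v i = 0) (hN : 2 ≤ Fintype.card ι) (D : Finset ι) (w : ι → ℝ) :
    Ex (fun σ : Equiv.Perm ι => (∑ i ∈ D, w i * v (σ i)) ^ 2) ≤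
     2 * (∑ i, v i ^ 2) / Fintype.card ι * (∑ i ∈ D, w i ^ 2) := by
  rw [full_moment v hv hN]
  have hN' : (2:ℝ) ≤ Fintype.card ι := by exact_mod_cast hN
  have h1 : 0 ≤ (∑ i, v i ^ 2) / (Fintype.card ι : ℝ) := div_nonneg (Finset.sum_nonneg fun _ _ => sq_nonneg _) (by linarith)
  have h2 : 0 ≤ ∑ i ∈ D, w i ^ 2 := Finset.sum_nonneg fun _ _ => sq_nonneg _
  have h3 : - ((∑ i ∈ D, w i) ^ 2 - ∑ i ∈ D, w i ^ 2) / (Fintype.card ι - 1 : ℝ) ≤ ∑ i ∈ D, w i ^ 2 := by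
    rw [div_le_iff₀ (by linarith)]
    nlinarith [sq_nonneg (∑ i ∈ D, w i)]
  rw [mul_div_assoc, mul_assoc, mul_comm 2, mul_assoc]
  apply mul_le_mul_of_nonneg_left _ h1
  rw [neg_div] at h3
  linarith

end exch

open Finset Polynomial

section variance
variable {ι : Type*} [Fintype ι] [DecidableEq ι]

lemma pair_moment (v : ι → ℝ) (hv : ∑ i, v i = 0) (hN : 2 ≤ Fintype.card ι) {p q : ι} (hpq : p ≠ q) :
    Ex (fun σ : Equiv.Perm ι => (v (σ q) - v (σ p)) ^ 2) = 2 * (∑ i, v i ^ 2) / (Fintype.card ι - 1) := by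
  have h := full_moment v hv hN {p, q} (fun i => if i = q then 1 else -1)
  have hN' : (2:ℝ) ≤ Fintype.card ι := by exact_mod_cast hN
  simp only [Finset.sum_pair hpq, if_neg hpq, if_true] at h
  have e : (fun σ : Equiv.Perm ι => (v (σ q) - v (σ p)) ^ 2) = fun σ : Equiv.Perm ι => (-1 * v (σ p) + 1 * v (σ q)) ^ 2 := by
    ext σ; ring
  rw [e, h]
  have : (Fintype.card ι : ℝ) - 1 ≠ 0 := by linarith
  have h0 : (Fintype.card ι : ℝ) ≠ 0 := by linarith
  field_simp
  ring

lemma sum_diff_sq (v : ι → ℝ) (hv : ∑ i, v i = 0) :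
    ∑ x : ι × ι, (v x.2 - v x.1) ^ 2 = 2 * Fintype.card ι * ∑ i, v i ^ 2 := by
  rw [Fintype.sum_prod_type]
  have : ∀ i j, (v j - v i)^2 = v j ^ 2 - 2 * v i * v j + v i ^ 2 := by intros; ring
  simp only [this, Finset.sum_add_distrib, Finset.sum_sub_distrib, ← Finset.mul_sum, hv]
  simp [← Finset.mul_sum]
  ring

lemma four_moment (v : ι → ℝ) (hv : ∑ i, v i = 0) (hN : 4 ≤ Fintype.card ι) (e : Fin 4 ↪ ι) :
    Ex (fun σ : Equiv.Perm ι => (v (σ (e 1)) - v (σ (e 0))) ^ 2 * (v (σ (e 3)) - v (σ (e 2))) ^ 2) *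
      ((Fintype.card ι).descFactorial 4 : ℝ) ≤ (2 * Fintype.card ι * ∑ i, v i ^ 2) ^ 2 := by
  classical
  set H : (Fin 4 → ι) → ℝ := fun t => (v (t 1) - v (t 0)) ^ 2 * (v (t 3) - v (t 2)) ^ 2 with hH
  have h1 : ∀ e' : Fin 4 ↪ ι, Ex (fun σ : Equiv.Perm ι => H (fun i => σ (e' i))) = Ex (fun σ : Equiv.Perm ι => H (fun i => σ (e i))) :=
    fun e' => Ex_tuple H e' e
  have h2 : Ex (fun σ : Equiv.Perm ι => H (fun i => σ (e i))) * ((Fintype.card ι).descFactorial 4 : ℝ) =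
      ∑ e' : Fin 4 ↪ ι, Ex (fun σ : Equiv.Perm ι => H (fun i => σ (e' i))) := by
    rw [Finset.sum_congr rfl fun e' _ => h1 e']
    simp [Fintype.card_embedding_eq, mul_comm]
  change Ex (fun σ : Equiv.Perm ι => H (fun i => σ (e i))) * _ ≤ _
  rw [h2, ← Ex_sum, ← Ex_const (α := Equiv.Perm ι) ((2 * (Fintype.card ι : ℝ) * ∑ i, v i ^ 2) ^ 2)]
  apply Ex_mono
  intro σ
  rw [← sum_diff_sq v hv, sq, Finset.sum_mul_sum, ← Finset.sum_product']
  set φ : (Fin 4 ↪ ι) → (ι × ι) × (ι × ι) := fun e' => ((σ (e' 0), σ (e' 1)), (σ (e' 2), σ (e' 3))) with hφ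
  have hinj : Function.Injective φ := by
    intro a b hab
    simp only [hφ, Prod.mk.injEq, EmbeddingLike.apply_eq_iff_eq] at hab
    obtain ⟨⟨h0, h1⟩, h2, h3⟩ := hab
    ext i
    fin_cases i <;> assumption
  have : ∑ e' : Fin 4 ↪ ι, H (fun i => σ (e' i)) =
      ∑ x ∈ Finset.univ.image φ, (v x.1.2 - v x.1.1) ^ 2 * (v x.2.2 - v x.2.1) ^ 2 := by
    rw [Finset.sum_image fun a _ b _ h => hinj h]
  rw [this]
  exact Finset.sum_le_sum_of_subset_of_nonneg (by intro x _; simp) fun _ _ _ => by positivity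

lemma inj_four {α : Type*} {a b c d : α} (h1 : a ≠ b) (h2 : a ≠ c) (h3 : a ≠ d) (h4 : b ≠ c) (h5 : b ≠ d)
    (h6 : c ≠ d) : Function.Injective ![a, b, c, d] := by
  intro i j hij
  fin_cases i <;> fin_cases j <;> simp_all
  all_goals first | exact absurd hij.symm (by assumption) | (exfalso; simp_all)

lemma descFact_four (n : ℕ) (hn : 10 ≤ n) : (n.descFactorial 4 : ℝ) = (n:ℝ) * (n-1) * (n-2) * (n-3) := by
  obtain ⟨m, rfl⟩ : ∃ m, n = m + 4 := ⟨n - 4, by omega⟩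
  simp only [Nat.descFactorial]
  rw [show m + 4 - 3 = m + 1 by omega, show m + 4 - 2 = m + 2 by omega, show m + 4 - 1 = m + 3 by omega]
  push_cast; ring

set_option maxHeartbeats 1000000 in
lemma variance_bound {κ : Type*} [DecidableEq κ] (v : ι → ℝ) (hv : ∑ i, v i = 0) (hN : 10 ≤ Fintype.card ι)
    (A : ℝ) (hA : ∀ i, |v i| ≤ A) (hV : 0 < ∑ i, v i ^ 2)
    (K : Finset κ) (p q : κ → ι) (hpq : ∀ k ∈ K, p k ≠ q k)
    (hdis : ∀ k ∈ K, ∀ l ∈ K, k ≠ l → p k ≠ p l ∧ p k ≠ q l ∧ q k ≠ q l)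
    (c : κ → ℝ) (hc : ∀ k ∈ K, 0 ≤ c k) (cm : ℝ) (hcm : ∀ k ∈ K, c k ≤ cm) (hθ : 0 < ∑ k ∈ K, c k) :
    Ex (fun σ : Equiv.Perm ι => ind (∑ k ∈ K, c k * (v (σ (q k)) - v (σ (p k))) ^ 2 <
        (∑ k ∈ K, c k) * (∑ i, v i ^ 2) / Fintype.card ι)) ≤
      4 * (4 * A ^ 2 * cm * Fintype.card ι / ((∑ k ∈ K, c k) * ∑ i, v i ^ 2) + 8 / Fintype.card ι) := by
  classical
  set N : ℝ := (Fintype.card ι : ℝ) with hNdef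
  set V2 := ∑ i, v i ^ 2 with hV2
  set θ := ∑ k ∈ K, c k with hθdef
  have hN' : (10:ℝ) ≤ N := by rw [hNdef]; exact_mod_cast hN
  set η := 2 * V2 / (N - 1) with hη
  have hN1 : 0 < N - 1 := by linarith
  have hη0 : 0 < η := by positivity
  set W : Equiv.Perm ι → ℝ := fun σ => ∑ k ∈ K, c k * (v (σ (q k)) - v (σ (p k))) ^ 2 with hW
  have hA0 : 0 ≤ A := by
    have : Nonempty ι := by
      rw [← Fintype.card_pos_iff]; omega
    exact le_trans (abs_nonneg _) (hA (Classical.arbitrary ι))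
  have hcm0 : 0 ≤ cm := by
    obtain ⟨k, hk, -⟩ := Finset.exists_ne_zero_of_sum_ne_zero hθ.ne'
    exact (hc k hk).trans (hcm k hk)
  have EW : Ex W = θ * η := by
    rw [hW, Ex_sum, hθdef, Finset.sum_mul]
    refine Finset.sum_congr rfl fun k hk => ?_
    rw [Ex_mul_left, pair_moment v hv (by omega) (hpq k hk)]
  set B := 4 * N * V2 ^ 2 / ((N-1) * (N-2) * (N-3)) with hB
  have hB0 : 0 ≤ B := by
    have : 0 < N - 2 := by linarith
    have : 0 < N - 3 := by linarith
    positivity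
  have hoff : ∀ k ∈ K, ∀ l ∈ K, k ≠ l → Ex (fun σ : Equiv.Perm ι => (v (σ (q k)) - v (σ (p k))) ^ 2 * (v (σ (q l)) - v (σ (p l))) ^ 2) ≤ B := by
    intro k hk l hl hkl
    obtain ⟨h1, h2, h3⟩ := hdis k hk l hl hkl
    obtain ⟨-, h4, -⟩ := hdis l hl k hk hkl.symm
    have h5 := hpq k hk
    have h6 := hpq l hl
    have hinj : Function.Injective ![p k, q k, p l, q l] := inj_four h5 h1 h2 (Ne.symm h4) h3 h6
    have := four_moment v hv (by omega) ⟨_, hinj⟩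
    simp only [Function.Embedding.coeFn_mk, Matrix.cons_val] at this
    have hd : ((Fintype.card ι).descFactorial 4 : ℝ) = N * (N-1) * (N-2) * (N-3) := by
      rw [descFact_four _ hN]
    rw [hd] at this
    have h2 : 0 < N - 2 := by linarith
    have h3 : 0 < N - 3 := by linarith
    rw [hB, le_div_iff₀ (by positivity)]
    have hNpos : 0 < N := by linarith
    refine le_of_mul_le_mul_left ?_ hNpos
    refine le_trans (le_of_eq ?_) (this.trans (le_of_eq ?_)) <;> ring
  have EW2 : Ex (fun σ => W σ ^ 2) ≤ 4 * A ^ 2 * η * (cm * θ) + B * θ ^ 2 := by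
    have e1 : (fun σ => W σ ^ 2) = fun σ => ∑ k ∈ K, ∑ l ∈ K, (c k * c l) * ((v (σ (q k)) - v (σ (p k))) ^ 2 * (v (σ (q l)) - v (σ (p l))) ^ 2) := by
      ext σ
      rw [hW, sq, Finset.sum_mul_sum]
      refine Finset.sum_congr rfl fun i _ => Finset.sum_congr rfl fun j _ => ?_
      ring
    rw [e1, Ex_sum]
    have e2 : ∀ k ∈ K, Ex (fun σ : Equiv.Perm ι => ∑ l ∈ K, (c k * c l) * ((v (σ (q k)) - v (σ (p k))) ^ 2 * (v (σ (q l)) - v (σ (p l))) ^ 2)) ≤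
        4 * A ^ 2 * η * (cm * c k) + B * (c k * θ) := by
      intro k hk
      rw [Ex_sum]
      have : ∀ l ∈ K, Ex (fun σ : Equiv.Perm ι => (c k * c l) * ((v (σ (q k)) - v (σ (p k))) ^ 2 * (v (σ (q l)) - v (σ (p l))) ^ 2)) ≤
          (if l = k then 4 * A ^ 2 * η * (cm * c k) else 0) + B * (c k * c l) := by
        intro l hl
        have hcc := mul_nonneg (hc k hk) (hc l hl)
        rw [Ex_mul_left]
        split_ifs with h
        · subst h
          have h1 : Ex (fun σ : Equiv.Perm ι => (v (σ (q l)) - v (σ (p l))) ^ 2 * (v (σ (q l)) - v (σ (p l))) ^ 2) ≤ 4 * A ^ 2 * η := by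
            rw [hη, ← pair_moment v hv (by omega) (hpq l hl), ← Ex_mul_left]
            apply Ex_mono
            intro σ
            apply mul_le_mul_of_nonneg_right _ (sq_nonneg _)
            have h1 := abs_le.1 (hA (σ (q l)))
            have h2 := abs_le.1 (hA (σ (p l)))
            nlinarith
          have h2 : c l * c l * Ex (fun σ : Equiv.Perm ι => (v (σ (q l)) - v (σ (p l))) ^ 2 * (v (σ (q l)) - v (σ (p l))) ^ 2) ≤ (cm * c l) * (4 * A^2 * η) := by
            apply mul_le_mul _ h1 _ _
            · exact mul_le_mul_of_nonneg_right (hcm l hl) (hc l hl)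
            · exact Ex_nonneg fun σ => by positivity
            · exact mul_nonneg hcm0 (hc l hl)
          have := mul_nonneg hB0 hcc
          linarith
        · rw [zero_add, mul_comm B]
          exact mul_le_mul_of_nonneg_left (hoff k hk l hl (Ne.symm h)) hcc
      refine (Finset.sum_le_sum this).trans (le_of_eq ?_)
      rw [Finset.sum_add_distrib, Finset.sum_ite_eq' K k, if_pos hk, ← Finset.mul_sum, ← Finset.mul_sum]
    refine (Finset.sum_le_sum e2).trans (le_of_eq ?_)
    rw [Finset.sum_add_distrib, ← Finset.mul_sum, ← Finset.mul_sum, ← Finset.mul_sum, ← Finset.sum_mul]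
    ring
  have hBη : B ≤ (1 + 8 / N) * η ^ 2 := by
    rw [hB, hη]
    have h2 : 0 < N - 2 := by linarith
    have h3 : 0 < N - 3 := by linarith
    have hNpos : 0 < N := by linarith
    rw [div_pow, show (1 + 8 / N) * ((2 * V2) ^ 2 / (N - 1) ^ 2) = ((N + 8) * (4 * V2 ^2)) / (N * (N-1)^2) by field_simp; ring]
    rw [div_le_div_iff₀ (by positivity) (by positivity)]
    have : 0 ≤ 4 * V2 ^ 2 * (N-1) * ((N+8) * (N-2) * (N-3) - N * N * (N-1)) := by
      apply mul_nonneg (by positivity)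
      nlinarith
    nlinarith
  have hvar : Ex (fun σ => (W σ - θ * η) ^ 2) ≤ 4 * A ^ 2 * η * (cm * θ) + 8 / N * (θ * η) ^ 2 := by
    have e1 : (fun σ => (W σ - θ * η) ^ 2) = fun σ => W σ ^ 2 - (2 * (θ * η)) * W σ + (θ * η) ^ 2 := by
      ext σ; ring
    rw [e1, Ex_add, Ex_sub, Ex_mul_left, Ex_const, EW]
    nlinarith [mul_le_mul_of_nonneg_right hBη (sq_nonneg θ)]
  have hmk := Ex_ind_le (Z := fun σ => (W σ - θ * η) ^ 2) (fun σ => sq_nonneg _) (t := (θ * η / 2) ^ 2) (by positivity)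
  have hNpos : 0 < N := by linarith
  calc Ex (fun σ : Equiv.Perm ι => ind (W σ < θ * V2 / N))
      ≤ Ex (fun σ => ind ((θ * η / 2) ^ 2 ≤ (W σ - θ * η) ^ 2)) := by
        apply Ex_mono; intro σ
        apply ind_mono
        intro h
        have h1 : θ * V2 / N ≤ θ * η / 2 := by
          rw [hη]
          rw [show θ * (2 * V2 / (N - 1)) / 2 = θ * V2 / (N - 1) by field_simp]
          apply div_le_div_of_nonneg_left (by positivity) hN1 (by linarith)
        have h2 : θ * η / 2 ≤ θ * η - W σ := by linarith
        rw [show (W σ - θ * η) ^ 2 = (θ * η - W σ) ^ 2 by ring]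
        exact pow_le_pow_left₀ (by positivity) h2 2
    _ ≤ _ := hmk
    _ ≤ (4 * A ^ 2 * η * (cm * θ) + 8 / N * (θ * η) ^ 2) / (θ * η / 2) ^ 2 := by gcongr
    _ = 4 * (4 * A ^ 2 * cm / (θ * η) + 8 / N) := by field_simp; ring
    _ ≤ _ := by
        gcongr 4 * (?_ + _)
        rw [div_le_div_iff₀ (by positivity) (by positivity)]
        have : V2 ≤ N * η := by
          rw [hη, mul_div_assoc', le_div_iff₀ hN1]; nlinarith
        have := mul_le_mul_of_nonneg_left this (show 0 ≤ 4 * A ^ 2 * cm * θ by positivity)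
        nlinarith

end variance

open Finset Polynomial

section core
variable {M : ℕ}

noncomputable def wt (M : ℕ) (i : Fin (M+1)) : ℝ := (i : ℝ) - M / 2

noncomputable def XX (v : Fin (M+1) → ℝ) (σ : Equiv.Perm (Fin (M+1))) : ℝ := ∑ i, wt M i * v (σ i)

lemma XX_swap (v : Fin (M+1) → ℝ) (σ : Equiv.Perm (Fin (M+1))) (i j : Fin (M+1)) :
    XX v (σ * Equiv.swap i j) = XX v σ + ((i:ℝ) - j) * (v (σ j) - v (σ i)) := by
  by_cases hij : i = j
  · subst hij; rw [Equiv.swap_self]; simp only [sub_self, zero_mul, add_zero]; rfl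
  have : XX v (σ * Equiv.swap i j) - XX v σ = ((i:ℝ) - j) * (v (σ j) - v (σ i)) := by
    unfold XX
    rw [← Finset.sum_sub_distrib, Fintype.sum_eq_add i j hij]
    · simp [wt]; ring
    · rintro x ⟨h1, h2⟩
      simp [Equiv.swap_apply_of_ne_of_ne h1 h2]
  linarith

noncomputable def cc (M : ℕ) (i : Fin M) : ℝ := ((i:ℝ) + 1) * (M - i)

lemma cc_nonneg (i : Fin M) : 0 ≤ cc M i := by
  have : (i:ℝ) ≤ M := by exact_mod_cast i.2.le
  unfold cc
  exact mul_nonneg (by positivity) (by linarith)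

lemma cc_le (i : Fin M) : cc M i ≤ ((M:ℝ)+1)^2 / 4 := by
  unfold cc
  nlinarith [sq_nonneg ((i:ℝ) + 1 - (M - i))]

lemma stein_sum (y : Fin (M+1) → ℝ) :
    ∑ i : Fin M, cc M i * (y i.succ - y i.castSucc) = 2 * ∑ i, wt M i * y i := by
  have h1 : ∑ i : Fin M, cc M i * y i.castSucc = ∑ j : Fin (M+1), ((j:ℝ)+1) * (M - j) * y j := by
    rw [Fin.sum_univ_castSucc]; simp [cc]
  have h2 : ∑ i : Fin M, cc M i * y i.succ = ∑ j : Fin (M+1), (j:ℝ) * (M + 1 - j) * y j := by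
    rw [Fin.sum_univ_succ]; simp [cc]
  simp only [mul_sub, Finset.sum_sub_distrib]
  rw [h1, h2, ← Finset.sum_sub_distrib, Finset.mul_sum]
  refine Finset.sum_congr rfl fun j _ => ?_
  unfold wt; ring

lemma stein_identity (v : Fin (M+1) → ℝ) (F : ℝ → ℝ) :
    ∑ i : Fin M, cc M i * Ex (fun σ => (XX v (σ * Equiv.swap i.castSucc i.succ) - XX v σ) *
      (F (XX v (σ * Equiv.swap i.castSucc i.succ)) - F (XX v σ))) = 4 * Ex (fun σ => XX v σ * F (XX v σ)) := by
  have h1 : ∀ i : Fin M, Ex (fun σ => (XX v (σ * Equiv.swap i.castSucc i.succ) - XX v σ) *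
      (F (XX v (σ * Equiv.swap i.castSucc i.succ)) - F (XX v σ))) =
      -2 * Ex (fun σ => (XX v (σ * Equiv.swap i.castSucc i.succ) - XX v σ) * F (XX v σ)) := by
    intro i
    have e := Ex_mulRight (Equiv.swap i.castSucc i.succ)
      (fun σ => (XX v (σ * Equiv.swap i.castSucc i.succ) - XX v σ) * F (XX v σ))
    simp only [mul_assoc, Equiv.swap_mul_self, mul_one] at e
    have e' : Ex (fun σ => (XX v σ - XX v (σ * Equiv.swap i.castSucc i.succ)) * F (XX v (σ * Equiv.swap i.castSucc i.succ))) 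
      = Ex (fun σ => (XX v (σ * Equiv.swap i.castSucc i.succ) - XX v σ) * F (XX v σ)) := e
    have e2 : Ex (fun σ => (XX v (σ * Equiv.swap i.castSucc i.succ) - XX v σ) * F (XX v (σ * Equiv.swap i.castSucc i.succ)))
      = - Ex (fun σ => (XX v (σ * Equiv.swap i.castSucc i.succ) - XX v σ) * F (XX v σ)) := by
      rw [← e', ← Ex_neg]; congr 1; ext σ; ring
    simp only [mul_sub]
    rw [Ex_sub, e2]; ring
  simp only [h1]
  rw [← Ex_mul_left]
  simp only [← Ex_mul_left]
  rw [← Ex_sum]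
  congr 1; ext σ
  have h2 := stein_sum (fun i => v (σ i))
  have h3 : ∀ i : Fin M, XX v (σ * Equiv.swap i.castSucc i.succ) - XX v σ = - (v (σ i.succ) - v (σ i.castSucc)) := by
    intro i; rw [XX_swap]; simp
  simp only [h3]
  have : ∑ i : Fin M, cc M i * (-2 * (-(v (σ i.succ) - v (σ i.castSucc)) * F (XX v σ))) =
    2 * F (XX v σ) * ∑ i : Fin M, cc M i * (v (σ i.succ) - v (σ i.castSucc)) := by
    rw [Finset.mul_sum]; refine Finset.sum_congr rfl fun j _ => ?_; ring
  rw [this, h2]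
  unfold XX; ring

lemma gdiff_lower (x y : ℝ) : (y - x) ^ 2 * |x| / 2 ≤ (y - x) * (y * |y| - x * |x|) := by
  rcases le_total 0 x with hx | hx <;> rcases le_total 0 y with hy | hy
  · rw [abs_of_nonneg hx, abs_of_nonneg hy]
    nlinarith [mul_nonneg (sq_nonneg (y-x)) hx, mul_nonneg (sq_nonneg (y-x)) hy]
  · rw [abs_of_nonneg hx, abs_of_nonpos hy]
    nlinarith [mul_nonneg (sq_nonneg (y-x)) hx, mul_nonneg (sq_nonneg (y+x)) hx, mul_nonneg (sq_nonneg (y+x)) (neg_nonneg.2 hy), mul_nonneg (sq_nonneg (y-x)) (neg_nonneg.2 hy)]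
  · rw [abs_of_nonpos hx, abs_of_nonneg hy]
    nlinarith [mul_nonneg (sq_nonneg (y-x)) hy, mul_nonneg (sq_nonneg (y+x)) hy, mul_nonneg (sq_nonneg (y+x)) (neg_nonneg.2 hx), mul_nonneg (sq_nonneg (y-x)) (neg_nonneg.2 hx)]
  · rw [abs_of_nonpos hx, abs_of_nonpos hy]
    nlinarith [mul_nonneg (sq_nonneg (y-x)) (neg_nonneg.2 hx), mul_nonneg (sq_nonneg (y-x)) (neg_nonneg.2 hy)]

/-- the auxiliary monotone function -/
noncomputable def gB (B x : ℝ) : ℝ := x * |x| + B * x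

lemma gB_lower (B x y : ℝ) : (y - x)^2 * (|x| + B) / 2 + (y-x)^2 * B / 2 ≤ (y - x) * (gB B y - gB B x) := by
  have := gdiff_lower x y
  unfold gB
  nlinarith

lemma gB_mono {B : ℝ} (hB : 0 ≤ B) {x y : ℝ} (h : x ≤ y) : gB B x ≤ gB B y := by
  rcases h.eq_or_lt with rfl | h
  · exact le_refl _
  have h1 := gB_lower B x y
  have h2 : 0 ≤ (y - x) * (gB B y - gB B x) := le_trans (by positivity) h1
  have := nonneg_of_mul_nonneg_right h2 (by linarith)
  linarith

lemma gB_upper {B r p q : ℝ} (hB : 0 ≤ B) (hp : |p| ≤ r) (hq : |q| ≤ r) :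
    |gB B p - gB B q| ≤ |p - q| * (2 * r + B) := by
  have h : gB B p - gB B q = (p - q) * |p| + q * (|p| - |q|) + B * (p - q) := by unfold gB; ring
  rw [h]
  have h1 : abs ((p - q) * |p|) ≤ |p - q| * r := by rw [abs_mul, abs_abs]; gcongr
  have h2 : abs (q * (|p| - |q|)) ≤ r * |p - q| := by
    rw [abs_mul]
    exact mul_le_mul hq (abs_abs_sub_abs_le p q) (abs_nonneg _) ((abs_nonneg q).trans hq)
  have h3 : |B * (p - q)| = B * |p - q| := by rw [abs_mul, abs_of_nonneg hB]
  have := abs_add_le ((p - q) * |p| + q * (|p| - |q|)) (B * (p - q))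
  have := abs_add_le ((p - q) * |p|) (q * (|p| - |q|))
  linarith

noncomputable def GB (B b L x : ℝ) : ℝ := gB B (max (b - 2 * L) (min (b + 3 * L) x)) 

lemma GB_mono {B b L : ℝ} (hB : 0 ≤ B) {x y : ℝ} (h : x ≤ y) : GB B b L x ≤ GB B b L y := by
  unfold GB
  apply gB_mono hB
  gcongr

lemma GB_prod_nonneg {B b L : ℝ} (hB : 0 ≤ B) (x y : ℝ) : 0 ≤ (y - x) * (GB B b L y - GB B b L x) := by
  rcases le_total x y with h | h
  · exact mul_nonneg (by linarith) (by linarith [GB_mono (b := b) (L := L) hB h])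
  · exact mul_nonneg_of_nonpos_of_nonpos (by linarith) (by linarith [GB_mono (b := b) (L := L) hB h])

lemma GB_lower {B b L x y : ℝ} (hB : 0 ≤ B) (h1 : b ≤ x) (h2 : x ≤ b + L) (h3 : |y - x| ≤ 2 * L) :
    (y - x)^2 * (|x| + B) / 2 ≤ (y - x) * (GB B b L y - GB B b L x) := by
  obtain ⟨h4, h5⟩ := abs_le.1 h3
  unfold GB
  rw [min_eq_right (by linarith), min_eq_right (by linarith), max_eq_right (by linarith), max_eq_right (by linarith)]
  have := gB_lower B x y
  have : 0 ≤ (y-x)^2 * B / 2 := by positivity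
  linarith

lemma GB_upper {B b L : ℝ} (hB : 0 ≤ B) (hL : 0 ≤ L) (x : ℝ) :
    x * (GB B b L x - GB B b L 0) ≤ 5 * L * (2 * x ^ 2 + B * |x|) := by
  set p := max (b - 2 * L) (min (b + 3 * L) x) with hp
  set q := max (b - 2 * L) (min (b + 3 * L) 0) with hq
  have hpq : p = q ∨ (|p| ≤ |x| ∧ |q| ≤ |x| ∧ |p - q| ≤ 5 * L) := by
    by_cases h : p = q
    · exact Or.inl h
    right
    have h1 : |p - q| ≤ 5 * L := by
      rw [abs_le]
      have : p ≤ b + 3 * L := max_le (by linarith) (min_le_left _ _)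
      have : q ≤ b + 3 * L := max_le (by linarith) (min_le_left _ _)
      have : b - 2 * L ≤ p := le_max_left _ _
      have : b - 2 * L ≤ q := le_max_left _ _
      constructor <;> linarith
    refine ⟨?_, ?_, h1⟩ <;>
    · rw [hp, hq] at *
      clear h1
      rcases abs_cases x with ⟨hx, _⟩ | ⟨hx, _⟩ <;> rw [hx, abs_le] <;> 
      rcases max_cases (b - 2 * L) (min (b + 3 * L) x) with ⟨e1, _⟩ | ⟨e1, _⟩ <;>
      rcases max_cases (b - 2 * L) (min (b + 3 * L) 0) with ⟨e2, _⟩ | ⟨e2, _⟩ <;>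
      rcases min_cases (b + 3 * L) x with ⟨e3, _⟩ | ⟨e3, _⟩ <;>
      rcases min_cases (b + 3 * L) 0 with ⟨e4, _⟩ | ⟨e4, _⟩ <;>
      simp only [e1, e2, e3, e4] at * <;>
      first
      | (constructor <;> linarith)
      | exact absurd trivial h
      | (exfalso; linarith)
      | (exfalso; apply h; linarith)
  have hR : 0 ≤ 5 * L * (2 * x ^ 2 + B * |x|) := by positivity
  rcases hpq with h | ⟨h1, h2, h3⟩
  · have : GB B b L x - GB B b L 0 = 0 := by unfold GB; rw [← hp, ← hq, h]; ring
    rw [this]; simpa using hR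
  · have := gB_upper hB h1 h2
    calc x * (GB B b L x - GB B b L 0) ≤ |x * (GB B b L x - GB B b L 0)| := le_abs_self _
      _ = |x| * |gB B p - gB B q| := by rw [abs_mul]; rfl
      _ ≤ |x| * (5 * L * (2 * |x| + B)) := by
          gcongr
          exact this.trans (by gcongr)
      _ = _ := by rw [← sq_abs x]; ring

end core

open Finset Polynomial

section core2
variable {M : ℕ}

noncomputable def WW (v : Fin (M+1) → ℝ) (σ : Equiv.Perm (Fin (M+1))) : ℝ :=
  ∑ i : Fin M, cc M i * (v (σ i.succ) - v (σ i.castSucc)) ^ 2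

lemma abs_wt_le (i : Fin (M+1)) : |wt M i| ≤ M / 2 := by
  have : (i:ℝ) ≤ M := by exact_mod_cast Nat.lt_succ_iff.1 i.2
  have h0 : (0:ℝ) ≤ i := by positivity
  unfold wt
  rw [abs_le]; constructor <;> linarith

lemma sum_wt_sq_le (D : Finset (Fin (M+1))) : ∑ i ∈ D, wt M i ^ 2 ≤ ((M:ℝ)+1)^3 / 4 := by
  calc ∑ i ∈ D, wt M i ^ 2 ≤ ∑ i : Fin (M+1), wt M i ^ 2 :=
        Finset.sum_le_sum_of_subset_of_nonneg (Finset.subset_univ _) fun _ _ _ => sq_nonneg _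
    _ ≤ ∑ i : Fin (M+1), (((M:ℝ)+1) / 2) ^ 2 := by
        refine Finset.sum_le_sum fun i _ => ?_
        rw [← sq_abs]
        have := abs_wt_le i
        gcongr; linarith
    _ = _ := by simp; ring

lemma Ex_XX_sq (hM : 1 ≤ M) (v : Fin (M+1) → ℝ) (hv : ∑ i, v i = 0) :
    Ex (fun σ => XX v σ ^ 2) ≤ ((M:ℝ)+1)^2 * (∑ i, v i ^ 2) := by
  have h := full_moment_le v hv (by simp; omega) Finset.univ (wt M)
  have h2 := sum_wt_sq_le (M := M) Finset.univ
  simp only [Fintype.card_fin] at h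
  have hV : 0 ≤ ∑ i, v i ^ 2 := Finset.sum_nonneg fun _ _ => sq_nonneg _
  refine h.trans ?_
  push_cast
  calc 2 * (∑ i, v i ^ 2) / ((M:ℝ) + 1) * (∑ i, wt M i ^ 2) ≤ 2 * (∑ i, v i ^ 2) / ((M:ℝ) + 1) * (((M:ℝ)+1)^3 / 4) := by gcongr
    _ = ((M:ℝ)+1)^2 * (∑ i, v i ^ 2) / 2 := by field_simp; ring
    _ ≤ _ := by linarith [mul_nonneg (sq_nonneg ((M:ℝ)+1)) hV]

lemma Ex_XX_abs (hM : 1 ≤ M) (v : Fin (M+1) → ℝ) (hv : ∑ i, v i = 0) {V : ℝ} (hV : 0 < V) (hV2 : V ^ 2 = ∑ i, v i ^ 2) :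
    Ex (fun σ => |XX v σ|) ≤ ((M:ℝ)+1) * V := by
  have := Ex_abs_le (ind := fun _ => 1) (Z := fun σ => XX v σ) (fun _ => by norm_num) (B := ((M:ℝ)+1) * V) (by positivity)
    (by simp only [one_mul, Ex_const, mul_one]; refine (Ex_XX_sq hM v hv).trans ?_; rw [← hV2]; exact le_of_eq (by ring))
  simpa [Ex_const] using this

lemma stein_part (hM : 1 ≤ M) (v : Fin (M+1) → ℝ) (hv : ∑ i, v i = 0) {V : ℝ} (hV : 0 < V) (hV2 : V ^ 2 = ∑ i, v i ^ 2)
    {L : ℝ} (hL : V ≤ L) (b : ℝ) :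
    Ex (fun σ => ind (b ≤ XX v σ ∧ XX v σ ≤ b + L) * (|XX v σ| + (M+1) * V) * WW v σ) ≤ 120 * L * (M+1)^2 * V^2 := by
  set B := ((M:ℝ)+1) * V with hB
  have hB0 : 0 ≤ B := by positivity
  have hL0 : 0 < L := by linarith
  have h := stein_identity v (fun x => GB B b L x - GB B b L 0)
  have h1 : Ex (fun σ => XX v σ * (GB B b L (XX v σ) - GB B b L 0)) ≤ 15 * L * B ^ 2 := by
    calc _ ≤ Ex (fun σ => 5 * L * (2 * XX v σ ^ 2 + B * |XX v σ|)) := Ex_mono fun σ => GB_upper hB0 hL0.le _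
      _ = 5 * L * (2 * Ex (fun σ => XX v σ ^ 2) + B * Ex (fun σ => |XX v σ|)) := by
          rw [Ex_mul_left, Ex_add, Ex_mul_left, Ex_mul_left]
      _ ≤ 5 * L * (2 * B ^ 2 + B * B) := by
          gcongr
          · refine (Ex_XX_sq hM v hv).trans ?_; rw [← hV2, hB]; exact le_of_eq (by ring)
          · exact Ex_XX_abs hM v hv hV hV2
      _ = _ := by ring
  have h2 : Ex (fun σ => (1/2) * (ind (b ≤ XX v σ ∧ XX v σ ≤ b + L) * (|XX v σ| + B) * WW v σ)) ≤ 
      ∑ i : Fin M, cc M i * Ex (fun σ => (XX v (σ * Equiv.swap i.castSucc i.succ) - XX v σ) *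
      ((GB B b L (XX v (σ * Equiv.swap i.castSucc i.succ)) - GB B b L 0) - (GB B b L (XX v σ) - GB B b L 0))) := by
    simp only [← Ex_mul_left]
    rw [← Ex_sum]
    apply Ex_mono; intro σ
    unfold WW
    rw [Finset.mul_sum, Finset.mul_sum]
    refine Finset.sum_le_sum fun i _ => ?_
    rw [sub_sub_sub_cancel_right]
    by_cases hI : b ≤ XX v σ ∧ XX v σ ≤ b + L
    · rw [ind_true hI]
      have hd : XX v (σ * Equiv.swap i.castSucc i.succ) - XX v σ = - (v (σ i.succ) - v (σ i.castSucc)) := by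
        rw [XX_swap]; simp
      have hne : i.succ ≠ i.castSucc := (Fin.castSucc_lt_succ).ne'
      have hsq : v (σ i.succ) ^ 2 + v (σ i.castSucc) ^ 2 ≤ V ^ 2 := by
        rw [hV2, ← Equiv.sum_comp σ (fun i => v i ^ 2), ← Finset.sum_pair (f := fun j => v (σ j) ^ 2) hne]
        exact Finset.sum_le_sum_of_subset_of_nonneg (Finset.subset_univ _) fun _ _ _ => sq_nonneg _
      have hle : |XX v (σ * Equiv.swap i.castSucc i.succ) - XX v σ| ≤ 2 * L := by
        rw [hd, abs_neg]
        apply abs_le_of_sq_le_sq _ (by linarith)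
        nlinarith [sq_nonneg (v (σ i.succ) + v (σ i.castSucc))]
      have := GB_lower hB0 hI.1 hI.2 hle
      have := mul_le_mul_of_nonneg_left this (cc_nonneg i)
      refine le_trans (le_of_eq ?_) this
      rw [hd]; ring
    · rw [ind_false hI]
      have := mul_nonneg (cc_nonneg i) (GB_prod_nonneg (b := b) (L := L) hB0 (XX v σ) (XX v (σ * Equiv.swap i.castSucc i.succ)))
      simpa using this
  rw [h, Ex_mul_left] at h2
  have : B ^ 2 = (M+1)^2 * V^2 := by rw [hB]; ring
  nlinarith

/-- residue classes of positions -/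
def Pc (M a : ℕ) : Finset (Fin (M+1)) := Finset.univ.filter fun i => (i:ℕ) / 2 % 3 = a

def Kc (M a : ℕ) : Finset (Fin M) := Finset.univ.filter fun i => (i:ℕ) % 6 = 2 * a

noncomputable def Wa (a : ℕ) (v : Fin (M+1) → ℝ) (σ : Equiv.Perm (Fin (M+1))) : ℝ :=
  ∑ i ∈ Kc M a, cc M i * (v (σ i.succ) - v (σ i.castSucc)) ^ 2

lemma Wa_le (a : ℕ) (v : Fin (M+1) → ℝ) (σ : Equiv.Perm (Fin (M+1))) : Wa a v σ ≤ WW v σ :=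
  Finset.sum_le_sum_of_subset_of_nonneg (Finset.subset_univ _) fun i _ _ => mul_nonneg (cc_nonneg i) (sq_nonneg _)

lemma theta_ge (hM : 24 ≤ M) {a : ℕ} (ha : a < 3) : ((M:ℝ)+1)^3 / 1536 ≤ ∑ i ∈ Kc M a, cc M i := by
  set q := M / 24 with hq
  have hq1 : 24 * q ≤ M := by omega
  have hq2 : M + 1 ≤ 48 * q := by omega
  have hq2' : (M:ℝ) + 1 ≤ 48 * q := by exact_mod_cast hq2
  have hq1' : 24 * (q:ℝ) ≤ M := by exact_mod_cast hq1
  let f : ℕ → ℕ := fun t => 6 * t + 2 * a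
  have hf : ∀ t ∈ Finset.Ico q (3*q), f t < M := by
    intro t ht; simp only [Finset.mem_Ico] at ht; simp only [f]; omega
  have h1 : ∑ t ∈ Finset.Ico q (3*q), (36 * (q:ℝ)^2) ≤ ∑ i ∈ Kc M a, cc M i := by
    have e : ∑ t ∈ Finset.Ico q (3*q), (36 * (q:ℝ)^2) = 
        ∑ i ∈ (Finset.Ico q (3*q)).attach.image (fun t => (⟨f t.1, hf t.1 t.2⟩ : Fin M)), (36 * (q:ℝ)^2) := by
      rw [Finset.sum_image, Finset.sum_attach (Finset.Ico q (3*q)) (fun _ => 36 * (q:ℝ)^2)]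
      intro x _ y _ hxy
      simp only [Fin.mk.injEq, f] at hxy
      exact Subtype.ext (by omega)
    rw [e]
    calc _ ≤ ∑ i ∈ (Finset.Ico q (3*q)).attach.image (fun t => (⟨f t.1, hf t.1 t.2⟩ : Fin M)), cc M i := by
          refine Finset.sum_le_sum fun i hi => ?_
          simp only [Finset.mem_image, Finset.mem_attach, true_and, Subtype.exists] at hi
          obtain ⟨t, ht, rfl⟩ := hi
          simp only [Finset.mem_Ico] at ht
          have g1 : (q:ℝ) ≤ t := by exact_mod_cast ht.1
          have g2 : (t:ℝ) + 1 ≤ 3 * q := by exact_mod_cast ht.2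
          have g3 : (a:ℝ) ≤ 2 := by exact_mod_cast (by omega : a ≤ 2)
          have g0 : (0:ℝ) ≤ a := by positivity
          have g4 : (0:ℝ) ≤ q := by positivity
          simp only [cc, f]
          push_cast
          have : 6 * (q:ℝ) * (6 * q) ≤ (6 * t + 2 * a + 1) * (M - (6 * t + 2 * a)) :=
            mul_le_mul (by linarith) (by linarith) (by linarith) (by linarith)
          linarith
      _ ≤ _ := by
          refine Finset.sum_le_sum_of_subset_of_nonneg ?_ fun i _ _ => cc_nonneg i
          intro i hi
          simp only [Finset.mem_image, Finset.mem_attach, true_and, Subtype.exists] at hi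
          obtain ⟨t, ht, rfl⟩ := hi
          simp only [Kc, Finset.mem_filter, Finset.mem_univ, true_and, f]
          omega
  refine le_trans ?_ h1
  rw [Finset.sum_const, Nat.card_Ico, nsmul_eq_mul, show 3 * q - q = 2 * q by omega]
  push_cast
  have : ((M:ℝ)+1)^3 ≤ (48 * (q:ℝ))^3 := by gcongr
  nlinarith

lemma Wa_prob (hM : 24 ≤ M) {a : ℕ} (ha : a < 3) (v : Fin (M+1) → ℝ) (hv : ∑ i, v i = 0) {V : ℝ} (hV : 0 < V) (hV2 : V ^ 2 = ∑ i, v i ^ 2)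
    {A : ℝ} (hA : ∀ i, |v i| ≤ A) :
    Ex (fun σ => ind (Wa a v σ < (M+1)^2 * V^2 / 1536)) ≤ 6176 * A^2 / V^2 := by
  have hθ := theta_ge hM ha
  set θ := ∑ i ∈ Kc M a, cc M i with hθd
  set N : ℝ := (M:ℝ) + 1 with hN
  have hN0 : 0 < N := by positivity
  have hθ0 : 0 < θ := lt_of_lt_of_le (by positivity) hθ
  have hVA : V ^ 2 ≤ N * A ^ 2 := by
    rw [hV2]
    calc ∑ i, v i ^ 2 ≤ ∑ i : Fin (M+1), A ^ 2 := Finset.sum_le_sum fun i _ => by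
          rw [← sq_abs]; have := hA i; gcongr
      _ = _ := by simp [hN]
  have h := variance_bound v hv (by simp; omega) A hA (by rw [← hV2]; positivity) (Kc M a) (fun i => i.castSucc) (fun i => i.succ)
    (fun k _ => (Fin.castSucc_lt_succ).ne) (by
      intro k hk l hl hkl
      simp only [Kc, Finset.mem_filter, Finset.mem_univ, true_and] at hk hl
      simp only [ne_eq, Fin.ext_iff, Fin.val_castSucc, Fin.val_succ] at hkl ⊢
      omega) (cc M) (fun k _ => cc_nonneg k) (N^2/4) (fun k _ => cc_le k) hθ0
  rw [← hV2, ← hθd] at h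
  simp only [Fintype.card_fin] at h
  push_cast at h
  rw [← hN] at h
  refine le_trans (Ex_mono fun σ => ind_mono fun hlt => lt_of_lt_of_le hlt ?_) (h.trans ?_)
  · rw [div_le_div_iff₀ (by norm_num) hN0]
    have : N^3 ≤ 1536 * θ := by linarith
    nlinarith [mul_le_mul_of_nonneg_right this (sq_nonneg V)]
  · have h1 : 4 * A ^ 2 * (N^2/4) * N / (θ * V^2) ≤ 1536 * A^2 / V^2 := by
      rw [div_le_div_iff₀ (by positivity) (by positivity)]
      have : N^3 ≤ 1536 * θ := by linarith
      nlinarith [mul_le_mul_of_nonneg_right this (show 0 ≤ A^2 * V^2 by positivity)]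
    have h2 : 8 / N ≤ 8 * A^2 / V^2 := by
      rw [div_le_div_iff₀ hN0 (by positivity)]; nlinarith
    have h3 : 6176 * A^2 / V^2 = 4 * (1536 * A^2 / V^2 + 8 * A^2 / V^2) := by ring
    linarith

end core2

open Finset Polynomial

section core3
variable {M : ℕ}

noncomputable def hcl (a i : ℕ) : ℝ := if i / 2 % 3 = a then 2 else -1

lemma hcl_abs (a i : ℕ) : |hcl a i| ≤ 2 := by
  unfold hcl; split_ifs <;> norm_num

lemma hcl_block (a m : ℕ) (ha : a < 3) (c : ℝ) :
    ∑ i ∈ range (6 * m), hcl a i * ((i:ℝ) - c) = (12 * a - 12) * m := by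
  induction m with
  | zero => simp
  | succ m ih =>
    rw [show 6 * (m+1) = 6 * m + 1 + 1 + 1 + 1 + 1 + 1 by ring]
    simp only [Finset.sum_range_succ, ih]
    have e0 : (6 * m) / 2 % 3 = 0 := by omega
    have e1 : (6 * m + 1) / 2 % 3 = 0 := by omega
    have e2 : (6 * m + 1 + 1) / 2 % 3 = 1 := by omega
    have e3 : (6 * m + 1 + 1 + 1) / 2 % 3 = 1 := by omega
    have e4 : (6 * m + 1 + 1 + 1 + 1) / 2 % 3 = 2 := by omega
    have e5 : (6 * m + 1 + 1 + 1 + 1 + 1) / 2 % 3 = 2 := by omega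
    simp only [hcl, e0, e1, e2, e3, e4, e5]
    push_cast
    interval_cases a <;> simp <;> ring

lemma class_sum_wt {a : ℕ} (ha : a < 3) : |∑ i ∈ Pc M a, wt M i| ≤ 5 * ((M:ℝ)+1) := by
  have hz : ∑ i : Fin (M+1), wt M i = 0 := by
    have h1 : ∑ i : Fin (M+1), wt M i.rev = ∑ i : Fin (M+1), wt M i := Equiv.sum_comp Fin.revPerm (wt M)
    have h2 : ∀ i : Fin (M+1), wt M i.rev = - wt M i := by
      intro i
      unfold wt
      have : (i:ℕ) ≤ M := Nat.lt_succ_iff.1 i.2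
      rw [Fin.val_rev, show M + 1 - (i + 1) = M - i by omega, Nat.cast_sub this]; ring
    simp only [h2, Finset.sum_neg_distrib] at h1
    linarith
  have h3 : 3 * ∑ i ∈ Pc M a, wt M i = ∑ i ∈ range (M+1), hcl a i * ((i:ℝ) - M/2) := by
    rw [← Fin.sum_univ_eq_sum_range (fun i => hcl a i * ((i:ℝ) - M/2))]
    have : 3 * ∑ i ∈ Pc M a, wt M i = 3 * ∑ i ∈ Pc M a, wt M i - ∑ i : Fin (M+1), wt M i := by rw [hz]; ring
    rw [this, Pc, Finset.sum_filter, Finset.mul_sum, ← Finset.sum_sub_distrib]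
    refine Finset.sum_congr rfl fun i _ => ?_
    unfold hcl wt
    split_ifs <;> ring
  set m := (M+1) / 6 with hm
  set r := (M+1) % 6 with hr
  have hmr : M + 1 = 6 * m + r := by omega
  have hr6 : r ≤ 5 := by omega
  have hsplit : ∑ i ∈ range (M+1), hcl a i * ((i:ℝ) - M/2) = (12 * a - 12) * m + 
      ∑ j ∈ range r, hcl a (6 * m + j) * (((6 * m + j : ℕ):ℝ) - M/2) := by
    rw [hmr, Finset.sum_range_add, hcl_block a m ha]
  have hrest : |∑ j ∈ range r, hcl a (6 * m + j) * (((6 * m + j : ℕ):ℝ) - M/2)| ≤ 5 * ((M:ℝ)+1) := by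
    calc _ ≤ ∑ j ∈ range r, |hcl a (6 * m + j) * (((6 * m + j : ℕ):ℝ) - M/2)| := Finset.abs_sum_le_sum_abs _ _
      _ ≤ ∑ j ∈ range r, ((M:ℝ)+1) := by
          refine Finset.sum_le_sum fun j hj => ?_
          rw [abs_mul]
          have h1 := hcl_abs a (6 * m + j)
          have h2 : |((6 * m + j : ℕ):ℝ) - M/2| ≤ ((M:ℝ)+1) / 2 := by
            have : ((6 * m + j : ℕ):ℝ) ≤ M := by
              have := Finset.mem_range.1 hj
              exact_mod_cast (by omega : 6 * m + j ≤ M)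
            have h0 : (0:ℝ) ≤ ((6 * m + j : ℕ):ℝ) := by positivity
            rw [abs_le]; constructor <;> linarith
          calc _ ≤ 2 * (((M:ℝ)+1) / 2) := mul_le_mul h1 h2 (abs_nonneg _) (by norm_num)
            _ = _ := by ring
      _ = r * ((M:ℝ)+1) := by simp; ring
      _ ≤ _ := by
          have : (r:ℝ) ≤ 5 := by exact_mod_cast hr6
          gcongr
  have hfirst : |(12 * (a:ℝ) - 12) * m| ≤ 2 * ((M:ℝ)+1) := by
    rw [abs_mul]
    have h1 : |12 * (a:ℝ) - 12| ≤ 12 := by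
      interval_cases a <;> norm_num
    have h2 : |(m:ℝ)| ≤ ((M:ℝ)+1)/6 := by
      rw [abs_of_nonneg (by positivity), le_div_iff₀ (by norm_num)]
      exact_mod_cast (by omega : m * 6 ≤ M + 1)
    calc _ ≤ 12 * (((M:ℝ)+1)/6) := mul_le_mul h1 h2 (abs_nonneg _) (by norm_num)
      _ = _ := by ring
  rw [hsplit] at h3
  have h4 := abs_add_le ((12 * (a:ℝ) - 12) * m) (∑ j ∈ range r, hcl a (6 * m + j) * (((6 * m + j : ℕ):ℝ) - M/2))
  rw [← h3, abs_mul, abs_of_pos (by norm_num : (0:ℝ) < 3)] at h4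
  have : (0:ℝ) ≤ M := by positivity
  linarith

lemma sum_wt_zero : ∑ i : Fin (M+1), wt M i = 0 := by
  have h1 : ∑ i : Fin (M+1), wt M i.rev = ∑ i : Fin (M+1), wt M i := Equiv.sum_comp Fin.revPerm (wt M)
  have h2 : ∀ i : Fin (M+1), wt M i.rev = - wt M i := by
    intro i
    unfold wt
    have : (i:ℕ) ≤ M := Nat.lt_succ_iff.1 i.2
    rw [Fin.val_rev, show M + 1 - (i + 1) = M - i by omega, Nat.cast_sub this]; ring
  simp only [h2, Finset.sum_neg_distrib] at h1
  linarith

lemma class_card (hM : 24 ≤ M) {a : ℕ} (ha : a < 3) : ((M:ℝ)+1) / 4 ≤ (Pc M a).card := by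
  have h : M + 1 ≤ 4 * (Pc M a).card := by
    set q := (M+1) / 6 with hq
    have : 2 * q ≤ (Pc M a).card := by
      let f : Fin (2 * q) → Fin (M+1) := fun t => ⟨6 * (t / 2) + 2 * a + t % 2, by have := t.2; omega⟩
      have hf : Function.Injective f := by
        intro x y hxy
        simp only [f, Fin.mk.injEq] at hxy
        exact Fin.ext (by omega)
      calc 2 * q = (Finset.univ.image f).card := by rw [Finset.card_image_of_injective _ hf]; simp
        _ ≤ _ := by
          apply Finset.card_le_card
          intro i hi
          simp only [Finset.mem_image, Finset.mem_univ, true_and] at hi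
          obtain ⟨t, rfl⟩ := hi
          simp only [Pc, Finset.mem_filter, Finset.mem_univ, true_and, f]
          omega
    omega
  rw [div_le_iff₀ (by norm_num)]
  have : ((M + 1 : ℕ):ℝ) ≤ ((4 * (Pc M a).card : ℕ) : ℝ) := by exact_mod_cast h
  push_cast at this
  linarith

/-- conditional size of partial sums -/
lemma part_abs (hM : 24 ≤ M) (v : Fin (M+1) → ℝ) {V : ℝ} (hV : 0 < V) (hV2 : V ^ 2 = ∑ i, v i ^ 2)
    (J : Equiv.Perm (Fin (M+1)) → ℝ) (hJ : ∀ σ, 0 ≤ J σ) (E D : Finset (Fin (M+1))) (hDE : D ⊆ E)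
    (hE : ((M:ℝ)+1) / 4 ≤ E.card) (hD : |∑ i ∈ D, wt M i| ≤ 5 * ((M:ℝ)+1))
    (hinv : ∀ σ, ∀ i ∈ E, ∀ j ∈ E, J (σ * Equiv.swap i j) = J σ) :
    Ex (fun σ => J σ * |∑ i ∈ D, wt M i * v (σ i)|) ≤ 4 * ((M:ℝ)+1) * V * Ex J := by
  set N : ℝ := (M:ℝ) + 1 with hN
  have hM' : (24:ℝ) ≤ M := by exact_mod_cast hM
  have hN0 : 25 ≤ N := by linarith
  have hEne : E.Nonempty := by
    rw [← Finset.card_pos]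
    have : (0:ℝ) < E.card := by linarith
    exact_mod_cast this
  obtain ⟨a, b, ha, hb, hc, -, -, h⟩ := exch_moment v J hJ E hEne hinv
  have hJ0 : 0 ≤ Ex J := Ex_nonneg hJ
  apply Ex_abs_le hJ (by positivity)
  rw [h D hDE]
  have hw := sum_wt_sq_le (M := M) D
  rw [← hN] at hw
  have hw0 : 0 ≤ ∑ i ∈ D, wt M i ^ 2 := Finset.sum_nonneg fun _ _ => sq_nonneg _
  have hs : (∑ i ∈ D, wt M i) ^ 2 ≤ 25 * N ^ 2 := by
    rw [← sq_abs]; nlinarith [abs_nonneg (∑ i ∈ D, wt M i)]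
  have hs0 := sq_nonneg (∑ i ∈ D, wt M i)
  obtain ⟨hb1, hb2⟩ := abs_le.1 hb
  have h1 : b * ((∑ i ∈ D, wt M i) ^ 2 - ∑ i ∈ D, wt M i ^ 2) ≤ a * ((∑ i ∈ D, wt M i) ^ 2 + ∑ i ∈ D, wt M i ^ 2) := by
    nlinarith
  have h2 : 2 * (∑ i ∈ D, wt M i ^ 2) + (∑ i ∈ D, wt M i) ^ 2 ≤ 4 * N ^ 3 := by nlinarith
  have h3 : N / 4 * a ≤ V^2 * Ex J := by
    rw [hV2]; exact (mul_le_mul_of_nonneg_right hE ha).trans hc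
  have h4 := mul_le_mul_of_nonneg_left h2 ha
  have h5 := mul_le_mul_of_nonneg_left h3 (show 0 ≤ 16 * N^2 by positivity)
  nlinarith

end core3

open Finset Polynomial

section chain
variable {M : ℕ}

lemma enum_exists (D : Finset (Fin (M+1))) : ∃ r : ℕ → Fin (M+1),
    (∀ p q, p < q → q < D.card → r p < r q) ∧ (∀ q, q < D.card → r q ∈ D) ∧
    ∀ f : Fin (M+1) → ℝ, ∑ i ∈ D, f i = ∑ q ∈ range D.card, f (r q) := by
  refine ⟨fun q => if h : q < D.card then D.orderEmbOfFin rfl ⟨q, h⟩ else 0, ?_, ?_, ?_⟩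
  · intro p q hpq hq
    simp only [dif_pos hq, dif_pos (hpq.trans hq)]
    exact (D.orderEmbOfFin rfl).strictMono hpq
  · intro q hq
    simp only [dif_pos hq]
    exact Finset.orderEmbOfFin_mem D rfl _
  · intro f
    rw [Finset.sum_range]
    simp only [Fin.is_lt, dif_pos, Fin.eta]
    conv_lhs => rw [← Finset.map_orderEmbOfFin_univ D rfl]
    rw [Finset.sum_map]
    rfl

def gch (r : ℕ → Fin (M+1)) : ℕ → Equiv.Perm (Fin (M+1))
  | 0 => 1
  | q+1 => gch r q * Equiv.swap (r q) (r (q+1))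

lemma gch_apply (r : ℕ → Fin (M+1)) (q : ℕ) : gch r q (r q) = r 0 := by
  induction q with
  | zero => rfl
  | succ q ih => simp [gch, ih]

lemma gch_fix (r : ℕ → Fin (M+1)) (s : ℕ) (hr : ∀ p q, p < q → q < s → r p < r q) (q j : ℕ) (hqj : q < j) (hj : j < s) :
    gch r q (r j) = r j := by
  induction q with
  | zero => rfl
  | succ q ih =>
    have h1 : r j ≠ r q := (hr q j (by omega) hj).ne'
    have h2 : r j ≠ r (q+1) := (hr (q+1) j hqj hj).ne'
    simp [gch, Equiv.swap_apply_of_ne_of_ne h1 h2, ih (by omega)]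

lemma gch_inv (r : ℕ → Fin (M+1)) (D : Finset (Fin (M+1))) (J : Equiv.Perm (Fin (M+1)) → ℝ)
    (hr : ∀ q, q < D.card → r q ∈ D)
    (hJ : ∀ σ, ∀ i ∈ D, ∀ j ∈ D, J (σ * Equiv.swap i j) = J σ) (σ : Equiv.Perm (Fin (M+1))) (q : ℕ) (hq : q < D.card) :
    J (σ * gch r q) = J σ := by
  induction q with
  | zero => simp [gch]
  | succ q ih =>
    rw [gch, ← mul_assoc, hJ _ _ (hr q (by omega)) _ (hr (q+1) hq), ih (by omega)]

lemma chain_step (v : Fin (M+1) → ℝ) (r : ℕ → Fin (M+1)) (s : ℕ) (hr : ∀ p q, p < q → q < s → r p < r q)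
    (σ : Equiv.Perm (Fin (M+1))) (q : ℕ) (hq : q + 1 < s) :
    XX v (σ * gch r (q+1)) = XX v (σ * gch r q) + ((r (q+1) : ℝ) - r q) * (v (σ (r 0)) - v (σ (r (q+1)))) := by
  rw [gch, ← mul_assoc, XX_swap]
  simp only [Equiv.Perm.mul_apply, gch_apply, gch_fix r s hr q (q+1) (by omega) hq]
  ring

lemma real_osc (s : ℕ) (x y ρ : ℕ → ℝ) (A : ℝ) (hy : ∀ q, |y q| ≤ A)
    (hρ : ∀ q, q + 1 < s → 1 ≤ ρ (q+1) - ρ q)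
    (hx : ∀ q, q + 1 < s → x (q+1) = x q + (ρ (q+1) - ρ q) * (A - y (q+1))) (p q : ℕ) (hpq : p ≤ q) (hq : q < s) :
    0 ≤ x q - x p ∧ x q - x p ≤ 2 * A * (ρ q - ρ p) ∧ ∑ j ∈ Finset.Ico p q, (A - y (j+1)) ≤ x q - x p := by
  induction q, hpq using Nat.le_induction with
  | base => simp
  | succ q hpq ih =>
    obtain ⟨h1, h2, h3⟩ := ih (by omega)
    have h4 := hρ q hq
    have h5 := hx q hq
    obtain ⟨h6, h7⟩ := abs_le.1 (hy (q+1))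
    rw [Finset.sum_Ico_succ_top hpq]
    have h8 : 0 ≤ A - y (q+1) := by linarith
    refine ⟨?_, ?_, ?_⟩ <;> nlinarith

lemma real_count (s : ℕ) (x y ρ : ℕ → ℝ) (A V L b : ℝ) (hA : 0 < A) (hAV : A ≤ V) (hVL : V ≤ L) (hy : ∀ q, |y q| ≤ A)
    (hρ : ∀ q, q + 1 < s → 1 ≤ ρ (q+1) - ρ q)
    (hx : ∀ q, q + 1 < s → x (q+1) = x q + (ρ (q+1) - ρ q) * (A - y (q+1)))
    (hV : ∑ q ∈ range s, y q ^ 2 ≤ V ^ 2) :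
    ∑ q ∈ range s, ind (b ≤ x q ∧ x q ≤ b + L) ≤ 7 * L * V / A ^ 2 := by
  classical
  have hR : 0 ≤ 7 * L * V / A ^ 2 := by
    have : 0 < V := by linarith
    have : 0 < L := by linarith
    positivity
  set Q := (range s).filter (fun q => b ≤ x q ∧ x q ≤ b + L) with hQ
  have e : ∑ q ∈ range s, ind (b ≤ x q ∧ x q ≤ b + L) = Q.card := by
    rw [hQ, Finset.card_filter]
    push_cast
    refine Finset.sum_congr rfl fun q _ => ?_
    split_ifs with h
    · rw [ind_true h]
    · rw [ind_false h]
  rw [e]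
  rcases Q.eq_empty_or_nonempty with h0 | hne
  · rw [h0]; simpa using hR
  set q0 := Q.min' hne with hq0
  set q1 := Q.max' hne with hq1
  have m0 : q0 ∈ Q := Q.min'_mem hne
  have m1 : q1 ∈ Q := Q.max'_mem hne
  have h01 : q0 ≤ q1 := Q.min'_le _ m1
  simp only [hQ, Finset.mem_filter, Finset.mem_range] at m0 m1
  have hcard : Q.card ≤ (q1 - q0) + 1 := by
    calc Q.card ≤ (Finset.Icc q0 q1).card := by
          apply Finset.card_le_card
          intro q hq
          exact Finset.mem_Icc.2 ⟨Q.min'_le _ hq, Q.le_max' _ hq⟩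
      _ = _ := by rw [Nat.card_Icc]; omega
  obtain ⟨-, -, h3⟩ := real_osc s x y ρ A hy hρ hx q0 q1 h01 m1.1
  have h4 : ∀ t : ℝ, A / 2 - 2 / A * t ^ 2 ≤ A - t := by
    intro t
    have : A - t - (A / 2 - 2 / A * t ^ 2) = ((A - t) ^ 2 + 3 * t ^ 2) / (2 * A) := by field_simp; ring
    have h : 0 ≤ ((A - t) ^ 2 + 3 * t ^ 2) / (2 * A) := by positivity
    linarith
  have h5 : ∑ j ∈ Finset.Ico q0 q1, (A / 2 - 2 / A * y (j+1) ^ 2) ≤ L := by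
    refine le_trans (Finset.sum_le_sum fun j _ => h4 (y (j+1))) (h3.trans ?_)
    linarith [m0.2.1, m1.2.2]
  rw [Finset.sum_sub_distrib, ← Finset.mul_sum] at h5
  simp only [Finset.sum_const, Nat.card_Ico, nsmul_eq_mul] at h5
  have h6 : ∑ j ∈ Finset.Ico q0 q1, y (j+1) ^ 2 ≤ V ^ 2 := by
    rw [Finset.sum_Ico_add' (fun j => y j ^ 2) q0 q1 1]
    refine le_trans (Finset.sum_le_sum_of_subset_of_nonneg ?_ fun _ _ _ => sq_nonneg _) hV
    intro j hj
    simp only [Finset.mem_Ico, Finset.mem_range] at *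
    omega
  have h7 : ((q1 - q0 : ℕ) : ℝ) ≤ 2 * L / A + 4 * V ^ 2 / A ^ 2 := by
    have : 2 / A * ∑ j ∈ Finset.Ico q0 q1, y (j+1) ^ 2 ≤ 2 / A * V ^ 2 := by gcongr
    have h8 : ((q1 - q0 : ℕ) : ℝ) * (A / 2) ≤ L + 2 / A * V ^ 2 := by linarith
    have h9 := mul_le_mul_of_nonneg_right h8 (show 0 ≤ 2 / A by positivity)
    have e1 : ((q1 - q0 : ℕ) : ℝ) * (A / 2) * (2 / A) = ((q1 - q0 : ℕ) : ℝ) := by field_simp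
    have e2 : (L + 2 / A * V ^ 2) * (2 / A) = 2 * L / A + 4 * V ^ 2 / A ^ 2 := by field_simp; ring
    linarith
  have h8 : (Q.card : ℝ) ≤ ((q1 - q0 : ℕ) : ℝ) + 1 := by exact_mod_cast hcard
  have h9 : 2 * L / A + 4 * V ^ 2 / A ^ 2 + 1 ≤ 7 * L * V / A ^ 2 := by
    rw [show 2 * L / A + 4 * V ^ 2 / A ^ 2 + 1 = (2 * L * A + 4 * V^2 + A^2) / A^2 by field_simp]
    gcongr
    nlinarith
  linarith

lemma real_chain (s : ℕ) (x y ρ : ℕ → ℝ) (A V L b B : ℝ) (hA : 0 < A) (hAV : A ≤ V) (hVL : V ≤ L) (hy : ∀ q, |y q| ≤ A)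
    (hρ : ∀ q, q + 1 < s → 1 ≤ ρ (q+1) - ρ q)
    (hx : ∀ q, q + 1 < s → x (q+1) = x q + (ρ (q+1) - ρ q) * (A - y (q+1)))
    (hV : ∑ q ∈ range s, y q ^ 2 ≤ V ^ 2) (hs : 0 < s) (hB : 0 ≤ B) (hosc : ∀ p q, 2 * A * (ρ q - ρ p) ≤ 2 * B) :
    ∑ q ∈ range s, ind (b ≤ x q ∧ x q ≤ b + L) * (|x q| + B) ≤ 7 * L * V / (A ^ 2 * s) * ∑ p ∈ range s, (|x p| + 3 * B) := by
  have h1 := real_count s x y ρ A V L b hA hAV hVL hy hρ hx hV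
  have h2 : ∀ p ∈ range s, ∀ q ∈ range s, |x q| + B ≤ |x p| + 3 * B := by
    intro p hp q hq
    rw [Finset.mem_range] at hp hq
    have : |x q - x p| ≤ 2 * B := by
      rcases le_total p q with h | h
      · obtain ⟨g1, g2, -⟩ := real_osc s x y ρ A hy hρ hx p q h hq
        rw [abs_of_nonneg g1]; exact g2.trans (hosc _ _)
      · obtain ⟨g1, g2, -⟩ := real_osc s x y ρ A hy hρ hx q p h hp
        rw [abs_sub_comm, abs_of_nonneg g1]; exact g2.trans (hosc _ _)
    have := abs_sub_abs_le_abs_sub (x q) (x p)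
    linarith
  have h3 : ∀ p ∈ range s, ∑ q ∈ range s, ind (b ≤ x q ∧ x q ≤ b + L) * (|x q| + B) ≤ 7 * L * V / A^2 * (|x p| + 3 * B) := by
    intro p hp
    calc _ ≤ ∑ q ∈ range s, ind (b ≤ x q ∧ x q ≤ b + L) * (|x p| + 3 * B) := 
          Finset.sum_le_sum fun q hq => mul_le_mul_of_nonneg_left (h2 p hp q hq) (ind_nonneg _)
      _ = (∑ q ∈ range s, ind (b ≤ x q ∧ x q ≤ b + L)) * (|x p| + 3 * B) := by rw [Finset.sum_mul]
      _ ≤ _ := by gcongr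
  have h4 := Finset.sum_le_sum h3
  rw [Finset.sum_const, Finset.card_range, nsmul_eq_mul, ← Finset.mul_sum] at h4
  have hs' : (0:ℝ) < s := by exact_mod_cast hs
  have e : 7 * L * V / (A ^ 2 * s) * ∑ p ∈ range s, (|x p| + 3 * B) = (7 * L * V / A ^ 2 * ∑ p ∈ range s, (|x p| + 3 * B)) / s := by
    field_simp
  rw [e, le_div_iff₀ hs']
  linarith

lemma chain_avg (r : ℕ → Fin (M+1)) (D : Finset (Fin (M+1)))
    (hsum : ∀ f : Fin (M+1) → ℝ, ∑ i ∈ D, f i = ∑ q ∈ range D.card, f (r q)) (h : Fin (M+1))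
    (G : Equiv.Perm (Fin (M+1)) → ℝ) :
    Ex (fun σ => ind (σ.symm h ∈ D) * G σ) = Ex (fun σ => ind (σ (r 0) = h) * ∑ q ∈ range D.card, G (σ * gch r q)) := by
  have h1 : ∀ σ : Equiv.Perm (Fin (M+1)), ind (σ.symm h ∈ D) = ∑ i ∈ D, ind (σ i = h) := by
    intro σ
    have e : ∀ i, ind (σ i = h) = if i = σ.symm h then 1 else 0 := by
      intro i
      split_ifs with hi
      · rw [ind_true]; rw [hi]; simp
      · rw [ind_false]; intro h2; apply hi; rw [← h2]; simp
    simp only [e, Finset.sum_ite_eq']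
    split_ifs with h2
    · rw [ind_true h2]
    · rw [ind_false h2]
  have h2 : (fun σ : Equiv.Perm (Fin (M+1)) => ind (σ.symm h ∈ D) * G σ) = fun σ => ∑ q ∈ range D.card, ind (σ (r q) = h) * G σ := by
    ext σ; rw [h1, hsum, Finset.sum_mul]
  rw [h2, Ex_sum]
  have h3 : (fun σ : Equiv.Perm (Fin (M+1)) => ind (σ (r 0) = h) * ∑ q ∈ range D.card, G (σ * gch r q)) =
    fun σ => ∑ q ∈ range D.card, ind (σ (r 0) = h) * G (σ * gch r q) := by
    ext σ; rw [Finset.mul_sum]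
  rw [h3, Ex_sum]
  refine Finset.sum_congr rfl fun q _ => ?_
  rw [← Ex_mulRight (gch r q)]
  simp only [Equiv.Perm.mul_apply, gch_apply]

lemma chain_lemma (v : Fin (M+1) → ℝ) {V : ℝ} (hV2 : V ^ 2 = ∑ i, v i ^ 2) {A L : ℝ} (b : ℝ) (hA : 0 < A) (hAV : A ≤ V)
    (hVL : V ≤ L) (hvA : ∀ i, |v i| ≤ A) (h : Fin (M+1)) (hh : v h = A) (D : Finset (Fin (M+1))) (hD : D.Nonempty)
    (J : Equiv.Perm (Fin (M+1)) → ℝ) (hJ0 : ∀ σ, 0 ≤ J σ)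
    (hJ : ∀ σ, ∀ i ∈ D, ∀ j ∈ D, J (σ * Equiv.swap i j) = J σ) :
    Ex (fun σ => ind (σ.symm h ∈ D) * (ind (b ≤ XX v σ ∧ XX v σ ≤ b + L) * (|XX v σ| + (M+1) * V) * J σ)) ≤
      7 * L * V / (A ^ 2 * D.card) * Ex (fun σ => (|XX v σ| + 3 * ((M+1) * V)) * J σ) := by
  obtain ⟨r, hr1, hr2, hr3⟩ := enum_exists D
  have hV : 0 < V := by linarith
  have hL : 0 < L := by linarith
  have hs : 0 < D.card := Finset.card_pos.2 hD
  calc _ ≤ 7 * L * V / (A ^ 2 * D.card) * Ex (fun σ => ind (σ.symm h ∈ D) * ((|XX v σ| + 3 * ((M+1) * V)) * J σ)) := by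
        rw [chain_avg r D hr3, chain_avg r D hr3, ← Ex_mul_left]
        apply Ex_mono
        intro σ
        by_cases h0 : σ (r 0) = h
        swap
        · rw [ind_false h0]; simp
        rw [ind_true h0, one_mul, one_mul]
        have e1 : ∀ q ∈ range D.card, ind (b ≤ XX v (σ * gch r q) ∧ XX v (σ * gch r q) ≤ b + L) * (|XX v (σ * gch r q)| + (M+1) * V) * J (σ * gch r q)
          = ind (b ≤ XX v (σ * gch r q) ∧ XX v (σ * gch r q) ≤ b + L) * (|XX v (σ * gch r q)| + (M+1) * V) * J σ := by
          intro q hq; rw [gch_inv r D J hr2 hJ σ q (Finset.mem_range.1 hq)]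
        have e2 : ∀ q ∈ range D.card, (|XX v (σ * gch r q)| + 3 * ((M+1) * V)) * J (σ * gch r q)
          = (|XX v (σ * gch r q)| + 3 * ((M+1) * V)) * J σ := by
          intro q hq; rw [gch_inv r D J hr2 hJ σ q (Finset.mem_range.1 hq)]
        rw [Finset.sum_congr rfl e1, Finset.sum_congr rfl e2, ← Finset.sum_mul, ← Finset.sum_mul, ← mul_assoc]
        apply mul_le_mul_of_nonneg_right _ (hJ0 σ)
        apply real_chain D.card (fun q => XX v (σ * gch r q)) (fun q => v (σ (r q))) (fun q => (r q : ℝ)) A V L b ((M+1)*V) hA hAV hVL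
          (fun q => hvA _) _ _ _ hs (by positivity)
        · intro p q
          have : ((r q : ℕ):ℝ) ≤ M := by exact_mod_cast Nat.lt_succ_iff.1 (r q).2
          have h0 : (0:ℝ) ≤ ((r p : ℕ):ℝ) := by positivity
          have h1 : ((r q : ℕ):ℝ) - (r p : ℕ) ≤ M + 1 := by linarith
          nlinarith
        · intro q hq
          have : (r q : ℕ) + 1 ≤ r (q+1) := hr1 q (q+1) (by omega) hq
          have : ((r q : ℕ):ℝ) + 1 ≤ (r (q+1) : ℕ) := by exact_mod_cast this
          linarith
        · intro q hq
          have := chain_step v r D.card hr1 σ q hq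
          rw [h0, hh] at this
          exact this
        · rw [hV2, ← hr3 (fun i => v (σ i) ^ 2), ← Equiv.sum_comp σ (fun i => v i ^ 2)]
          exact Finset.sum_le_sum_of_subset_of_nonneg (Finset.subset_univ _) fun _ _ _ => sq_nonneg _
    _ ≤ _ := by
        gcongr
        apply Ex_mono; intro σ
        have := ind_le_one (σ.symm h ∈ D)
        have : 0 ≤ (|XX v σ| + 3 * ((M+1) * V)) * J σ := mul_nonneg (by positivity) (hJ0 σ)
        nlinarith

end chain

open Finset Polynomial

section core4
variable {M : ℕ}

lemma Wa_inv {b : ℕ} (hb : b < 3) (v : Fin (M+1) → ℝ) (σ : Equiv.Perm (Fin (M+1))) (i j : Fin (M+1)) (hi : i ∉ Pc M b) (hj : j ∉ Pc M b) :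
    Wa b v (σ * Equiv.swap i j) = Wa b v σ := by
  unfold Wa
  refine Finset.sum_congr rfl fun k hk => ?_
  simp only [Kc, Finset.mem_filter, Finset.mem_univ, true_and] at hk
  simp only [Pc, Finset.mem_filter, Finset.mem_univ, true_and] at hi hj
  have h1 : k.castSucc ≠ i := by rintro rfl; apply hi; simp only [Fin.val_castSucc]; omega
  have h2 : k.castSucc ≠ j := by rintro rfl; apply hj; simp only [Fin.val_castSucc]; omega
  have h3 : k.succ ≠ i := by rintro rfl; apply hi; simp only [Fin.val_succ]; omega
  have h4 : k.succ ≠ j := by rintro rfl; apply hj; simp only [Fin.val_succ]; omega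
  simp only [Equiv.Perm.mul_apply, Equiv.swap_apply_of_ne_of_ne h1 h2, Equiv.swap_apply_of_ne_of_ne h3 h4]

lemma Pc_disj {a b : ℕ} (hab : a ≠ b) {i : Fin (M+1)} (hi : i ∈ Pc M a) : i ∉ Pc M b := by
  simp only [Pc, Finset.mem_filter, Finset.mem_univ, true_and] at hi ⊢
  omega

lemma class_part (hM : 24 ≤ M) (v : Fin (M+1) → ℝ) (hv : ∑ i, v i = 0) {V : ℝ} (hV2 : V ^ 2 = ∑ i, v i ^ 2) {A L : ℝ} (β : ℝ) (hA : 0 < A) (hAV : A ≤ V)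
    (hVL : V ≤ L) (hvA : ∀ i, |v i| ≤ A) (h : Fin (M+1)) (hh : v h = A) {a b c : ℕ} (ha : a < 3) (hb : b < 3) (hc : c < 3)
    (hab : a ≠ b) (hac : a ≠ c) (hbc : b ≠ c) :
    Ex (fun σ => ind (σ.symm h ∈ Pc M a) * (ind (β ≤ XX v σ ∧ XX v σ ≤ β + L) * (|XX v σ| + (M+1) * V) *
      (ind (Wa b v σ < (M+1)^2 * V^2 / 1536) * ind (Wa c v σ < (M+1)^2 * V^2 / 1536)))) ≤ 1902208 * L := by
  have hV : 0 < V := by linarith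
  have hL : 0 < L := by linarith
  have pb := Wa_prob hM hb v hv hV hV2 hvA
  have pc := Wa_prob hM hc v hv hV hV2 hvA
  set t := (M+1)^2 * V^2 / 1536 with ht
  set N : ℝ := (M:ℝ) + 1 with hN
  have hN0 : 0 < N := by positivity
  set p := 6176 * A^2 / V^2 with hp
  have hcard := class_card hM ha
  rw [← hN] at hcard
  have hcard0 : (0:ℝ) < (Pc M a).card := lt_of_lt_of_le (by positivity) hcard
  have hne : (Pc M a).Nonempty := by rw [← Finset.card_pos]; exact_mod_cast hcard0
  set J : Equiv.Perm (Fin (M+1)) → ℝ := fun σ => ind (Wa b v σ < t) * ind (Wa c v σ < t) with hJ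
  have hJ0 : ∀ σ, 0 ≤ J σ := fun σ => mul_nonneg (ind_nonneg _) (ind_nonneg _)
  have h1 := chain_lemma v hV2 β hA hAV hVL hvA h hh (Pc M a) hne J hJ0 (by
    intro σ i hi j hj
    simp only [hJ, Wa_inv hb v σ i j (Pc_disj hab hi) (Pc_disj hab hj), Wa_inv hc v σ i j (Pc_disj hac hi) (Pc_disj hac hj)])
  rw [← hN] at h1
  refine h1.trans ?_
  have hcompl : ∀ d, d < 3 → a ≠ d → N / 4 ≤ ((Pc M d)ᶜ.card : ℝ) := by
    intro d hd had
    refine hcard.trans ?_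
    exact_mod_cast Finset.card_le_card fun i hi => Finset.mem_compl.2 (Pc_disj had hi)
  have q1 := part_abs hM v hV hV2 (fun σ => ind (Wa c v σ < t)) (fun _ => ind_nonneg _) (Pc M c)ᶜ (Pc M b)
    (fun i hi => Finset.mem_compl.2 (Pc_disj hbc hi)) (hcompl c hc hac) (class_sum_wt hb) (by
      intro σ i hi j hj
      simp only [Wa_inv hc v σ i j (Finset.mem_compl.1 hi) (Finset.mem_compl.1 hj)])
  have hsc : ∑ i ∈ (Pc M b)ᶜ, wt M i = - ∑ i ∈ Pc M b, wt M i := by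
    have := Finset.sum_add_sum_compl (Pc M b) (wt M)
    rw [sum_wt_zero] at this; linarith
  have q2 := part_abs hM v hV hV2 (fun σ => ind (Wa b v σ < t)) (fun _ => ind_nonneg _) (Pc M b)ᶜ (Pc M b)ᶜ
    (le_refl _) (hcompl b hb hab) (by rw [hsc, abs_neg]; exact class_sum_wt hb) (by
      intro σ i hi j hj
      simp only [Wa_inv hb v σ i j (Finset.mem_compl.1 hi) (Finset.mem_compl.1 hj)])
  rw [← hN] at q1 q2
  have hpw : Ex (fun σ => (|XX v σ| + 3 * (N * V)) * J σ) ≤ Ex (fun σ => ind (Wa c v σ < t) * |∑ i ∈ Pc M b, wt M i * v (σ i)|) +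
      Ex (fun σ => ind (Wa b v σ < t) * |∑ i ∈ (Pc M b)ᶜ, wt M i * v (σ i)|) + 3 * (N * V) * Ex (fun σ => ind (Wa b v σ < t)) := by
    rw [← Ex_mul_left, ← Ex_add, ← Ex_add]
    apply Ex_mono; intro σ
    have hX : |XX v σ| ≤ |∑ i ∈ Pc M b, wt M i * v (σ i)| + |∑ i ∈ (Pc M b)ᶜ, wt M i * v (σ i)| := by
      have := Finset.sum_add_sum_compl (Pc M b) (fun i => wt M i * v (σ i))
      unfold XX
      rw [← this]; exact abs_add_le _ _
    have j1 : J σ ≤ ind (Wa b v σ < t) := by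
      have := ind_le_one (Wa c v σ < t); have := ind_nonneg (Wa b v σ < t); simp only [hJ]; nlinarith
    have j2 : J σ ≤ ind (Wa c v σ < t) := by
      have := ind_le_one (Wa b v σ < t); have := ind_nonneg (Wa c v σ < t); simp only [hJ]; nlinarith
    have k0 := mul_le_mul_of_nonneg_right hX (hJ0 σ)
    have k1 := mul_le_mul_of_nonneg_right j2 (abs_nonneg (∑ i ∈ Pc M b, wt M i * v (σ i)))
    have k2 := mul_le_mul_of_nonneg_right j1 (abs_nonneg (∑ i ∈ (Pc M b)ᶜ, wt M i * v (σ i)))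
    have k3 := mul_le_mul_of_nonneg_left j1 (show 0 ≤ 3 * (N * V) by positivity)
    nlinarith
  have hNV : 0 < N * V := by positivity
  have hE : Ex (fun σ => (|XX v σ| + 3 * (N * V)) * J σ) ≤ 11 * (N * V) * p := by
    have k1 := mul_le_mul_of_nonneg_left pc (show 0 ≤ 4 * N * V by positivity)
    have k2 := mul_le_mul_of_nonneg_left pb (show 0 ≤ 4 * N * V by positivity)
    have k3 := mul_le_mul_of_nonneg_left pb (show 0 ≤ 3 * (N * V) by positivity)
    linarith
  have hp0 : 0 ≤ p := by positivity
  calc _ ≤ 7 * L * V / (A ^ 2 * (N / 4)) * (11 * (N * V) * p) := by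
          gcongr
          exact Ex_nonneg fun σ => mul_nonneg (by positivity) (hJ0 σ)
    _ = 1902208 * L := by rw [hp]; field_simp; ring

lemma core_pos (hM : 24 ≤ M) (v : Fin (M+1) → ℝ) (hv : ∑ i, v i = 0) {V : ℝ} (hV2 : V ^ 2 = ∑ i, v i ^ 2) {A L : ℝ} (β : ℝ) (hA : 0 < A) (hAV : A ≤ V)
    (hVL : V ≤ L) (hvA : ∀ i, |v i| ≤ A) (h : Fin (M+1)) (hh : v h = A) :
    Ex (fun σ => ind (β ≤ XX v σ ∧ XX v σ ≤ β + L) * (|XX v σ| + (M+1) * V)) ≤ 6000000 * L := by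
  have hV : 0 < V := by linarith
  have hL : 0 < L := by linarith
  have c0 := class_part hM v hv hV2 β hA hAV hVL hvA h hh (a := 0) (b := 1) (c := 2) (by norm_num) (by norm_num) (by norm_num) (by norm_num) (by norm_num) (by norm_num)
  have c1 := class_part hM v hv hV2 β hA hAV hVL hvA h hh (a := 1) (b := 0) (c := 2) (by norm_num) (by norm_num) (by norm_num) (by norm_num) (by norm_num) (by norm_num)
  have c2 := class_part hM v hv hV2 β hA hAV hVL hvA h hh (a := 2) (b := 0) (c := 1) (by norm_num) (by norm_num) (by norm_num) (by norm_num) (by norm_num) (by norm_num)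
  have s := stein_part (by omega) v hv hV hV2 hVL β
  set t : ℝ := (M+1)^2 * V^2 / 1536 with ht
  have ht0 : 0 < t := by positivity
  set f : Equiv.Perm (Fin (M+1)) → ℝ := fun σ => ind (β ≤ XX v σ ∧ XX v σ ≤ β + L) * (|XX v σ| + (M+1) * V) with hf
  have hf0 : ∀ σ, 0 ≤ f σ := fun σ => mul_nonneg (ind_nonneg _) (by positivity)
  have s' : Ex (fun σ => f σ * WW v σ) ≤ 184320 * L * t := by
    refine s.trans (le_of_eq ?_); rw [ht]; ring
  have key : ∀ σ, f σ ≤ (1 / t) * (f σ * WW v σ) + ((ind (σ.symm h ∈ Pc M 0) * (f σ * (ind (Wa 1 v σ < t) * ind (Wa 2 v σ < t)))) +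
    (ind (σ.symm h ∈ Pc M 1) * (f σ * (ind (Wa 0 v σ < t) * ind (Wa 2 v σ < t)))) +
    (ind (σ.symm h ∈ Pc M 2) * (f σ * (ind (Wa 0 v σ < t) * ind (Wa 1 v σ < t))))) := by
    intro σ
    have hW0 : 0 ≤ WW v σ := Finset.sum_nonneg fun i _ => mul_nonneg (cc_nonneg i) (sq_nonneg _)
    have n0 : ∀ a b c, 0 ≤ ind (σ.symm h ∈ Pc M a) * (f σ * (ind (Wa b v σ < t) * ind (Wa c v σ < t))) := fun a b c =>
      mul_nonneg (ind_nonneg _) (mul_nonneg (hf0 σ) (mul_nonneg (ind_nonneg _) (ind_nonneg _)))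
    have n1 := n0 0 1 2
    have n2 := n0 1 0 2
    have n3 := n0 2 0 1
    by_cases hW : WW v σ < t
    · have hw : ∀ a, Wa a v σ < t := fun a => (Wa_le a v σ).trans_lt hW
      have n4 : 0 ≤ (1 / t) * (f σ * WW v σ) := by have := hf0 σ; positivity
      simp only [ind_true (hw _), mul_one] at n1 n2 n3 ⊢
      have : σ.symm h ∈ Pc M 0 ∨ σ.symm h ∈ Pc M 1 ∨ σ.symm h ∈ Pc M 2 := by
        simp only [Pc, Finset.mem_filter, Finset.mem_univ, true_and]; omega
      rcases this with g | g | g <;> rw [ind_true g] at * <;> linarith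
    · have : f σ ≤ (1 / t) * (f σ * WW v σ) := by
        rw [one_div, inv_mul_eq_div, le_div_iff₀ ht0]
        exact mul_le_mul_of_nonneg_left (not_lt.1 hW) (hf0 σ)
      linarith
  have := Ex_mono key
  rw [Ex_add, Ex_add, Ex_add, Ex_mul_left] at this
  have s2 : 1 / t * Ex (fun σ => f σ * WW v σ) ≤ 184320 * L := by
    rw [one_div, inv_mul_eq_div, div_le_iff₀ ht0]; exact s'
  linarith

lemma core_small (hM : 1 ≤ M) (hM2 : M < 24) (v : Fin (M+1) → ℝ) (hv : ∑ i, v i = 0) {V : ℝ} (hV : 0 < V) (hV2 : V ^ 2 = ∑ i, v i ^ 2) {L : ℝ} (β : ℝ) 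
    (hVL : V ≤ L) :
    Ex (fun σ => ind (β ≤ XX v σ ∧ XX v σ ≤ β + L) * (|XX v σ| + (M+1) * V)) ≤ 50 * L := by
  have h1 : Ex (fun σ => ind (β ≤ XX v σ ∧ XX v σ ≤ β + L) * (|XX v σ| + (M+1) * V)) ≤ Ex (fun σ => |XX v σ| + (M+1) * V) := by
    apply Ex_mono; intro σ
    have := ind_le_one (β ≤ XX v σ ∧ XX v σ ≤ β + L)
    have h0 : 0 ≤ |XX v σ| + (M+1) * V := by positivity
    nlinarith
  rw [Ex_add, Ex_const] at h1
  have h2 := Ex_XX_abs hM v hv hV hV2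
  have : (M:ℝ) + 1 ≤ 24 := by exact_mod_cast hM2
  nlinarith

lemma XX_neg (v : Fin (M+1) → ℝ) (σ : Equiv.Perm (Fin (M+1))) : XX (fun i => - v i) σ = - XX v σ := by
  simp [XX]

/-- core lemma -/
lemma core (v : Fin (M+1) → ℝ) (hv : ∑ i, v i = 0) {V : ℝ} (hV : 0 < V) (hV2 : V ^ 2 = ∑ i, v i ^ 2) {L : ℝ} (β : ℝ) 
    (hVL : V ≤ L) :
    Ex (fun σ => ind (β ≤ XX v σ ∧ XX v σ ≤ β + L) * (|XX v σ| + (M+1) * V)) ≤ 6000000 * L := by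
  have hL : 0 < L := by linarith
  rcases Nat.eq_zero_or_pos M with h0 | hM
  · subst h0
    simp at hv hV2
    rw [hv] at hV2
    simp at hV2
    exact absurd hV2 hV.ne'
  by_cases hM2 : M < 24
  · exact (core_small hM hM2 v hv hV hV2 β hVL).trans (by linarith)
  push Not at hM2
  obtain ⟨h, -, hmax⟩ := Finset.exists_max_image Finset.univ (fun i => |v i|) Finset.univ_nonempty
  have hvA : ∀ i, |v i| ≤ |v h| := fun i => hmax i (Finset.mem_univ _)
  have hA : 0 < |v h| := by
    by_contra hcon
    have hz : ∀ i, v i = 0 := fun i => abs_nonpos_iff.1 ((hvA i).trans (not_lt.1 hcon))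
    simp [hz] at hV2
    exact hV.ne' hV2
  have hAV : |v h| ≤ V := by
    apply abs_le_of_sq_le_sq _ hV.le
    rw [hV2]; exact Finset.single_le_sum (f := fun i => v i ^ 2) (fun _ _ => sq_nonneg _) (Finset.mem_univ h)
  rcases le_total 0 (v h) with h1 | h1
  · exact core_pos hM2 v hv hV2 β hA hAV hVL hvA h (abs_of_nonneg h1).symm
  · have := core_pos hM2 (fun i => - v i) (by simp [hv]) (V := V) (by simp [hV2]) (- β - L) hA hAV hVL (by simpa using hvA) h (abs_of_nonpos h1).symm
    refine le_trans (le_of_eq ?_) this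
    congr 1; ext σ
    rw [XX_neg, abs_neg]
    congr 1
    apply ind_congr
    constructor <;> rintro ⟨g1, g2⟩ <;> constructor <;> linarith

end core4

open Finset Polynomial

section two
variable {M : ℕ}

lemma Ex_XX_abs_le (v : Fin (M+1) → ℝ) (hv : ∑ i, v i = 0) {V : ℝ} (hV : 0 < V) (hV2 : ∑ i, v i ^ 2 ≤ V ^ 2) :
    Ex (fun σ => |XX v σ|) ≤ ((M:ℝ)+1) * V := by
  rcases Nat.eq_zero_or_pos M with h0 | hM
  · subst h0
    have : ∀ σ, XX v σ = 0 := by intro σ; simp [XX, wt]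
    simp only [this, abs_zero, Ex_const]
    positivity
  have := Ex_abs_le (ind := fun _ => 1) (Z := fun σ => XX v σ) (fun _ => by norm_num) (B := ((M:ℝ)+1) * V) (by positivity)
    (by
      simp only [one_mul, Ex_const, mul_one]; refine (Ex_XX_sq hM v hv).trans ?_
      rw [mul_pow]; gcongr)
  simpa [Ex_const] using this

lemma two_class_aux (u0 u1 : Fin (M+1) → ℝ) (h0 : ∑ i, u0 i = 0) (h1 : ∑ i, u1 i = 0) {V L : ℝ} (hV : 0 < V) (hVL : V ≤ L)
    (b : ℝ) (hu0 : ∑ i, u0 i ^ 2 ≤ V ^ 2) (hu1 : ∑ i, u1 i ^ 2 ≤ V ^ 2) (hbig : V ^ 2 / 9 ≤ ∑ i, u0 i ^ 2) :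
    Ex (fun σ1 => Ex (fun σ0 => ind (b ≤ XX u0 σ0 + XX u1 σ1 ∧ XX u0 σ0 + XX u1 σ1 ≤ b + L) *
      (|XX u0 σ0 + XX u1 σ1| + (M+1) * V))) ≤ 36000000 * L := by
  set V0 := √(∑ i, u0 i ^ 2) with hV0d
  have hL : 0 < L := by linarith
  have hs : 0 < ∑ i, u0 i ^ 2 := lt_of_lt_of_le (by positivity) hbig
  have hV0 : 0 < V0 := Real.sqrt_pos.2 hs
  have hV02 : V0 ^ 2 = ∑ i, u0 i ^ 2 := Real.sq_sqrt hs.le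
  have hV0V : V0 ≤ V := by rw [← hV02] at hu0; exact le_of_sq_le_sq hu0 hV.le
  have hV0V' : V ≤ 3 * V0 := by
    rw [← hV02] at hbig; apply le_of_sq_le_sq _ (by positivity); linarith [hbig, mul_pow 3 V0 2]
  set N : ℝ := (M:ℝ) + 1 with hN
  have hN0 : 0 < N := by positivity
  have key : ∀ σ1, Ex (fun σ0 => ind (b ≤ XX u0 σ0 + XX u1 σ1 ∧ XX u0 σ0 + XX u1 σ1 ≤ b + L) *
      (|XX u0 σ0 + XX u1 σ1| + N * V)) ≤ 18000000 * L * (1 + |XX u1 σ1| / (N * V)) := by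
    intro σ1
    set d := XX u1 σ1 with hd
    have hc := core u0 h0 hV0 hV02 (b - d) (hV0V.trans hVL)
    rw [← hN] at hc
    calc _ ≤ Ex (fun σ0 => (3 * (1 + |d| / (N * V))) * (ind (b - d ≤ XX u0 σ0 ∧ XX u0 σ0 ≤ b - d + L) * (|XX u0 σ0| + N * V0))) := by
          apply Ex_mono; intro σ0
          have e : ind (b ≤ XX u0 σ0 + d ∧ XX u0 σ0 + d ≤ b + L) = ind (b - d ≤ XX u0 σ0 ∧ XX u0 σ0 ≤ b - d + L) := by
            apply ind_congr; constructor <;> rintro ⟨g1, g2⟩ <;> constructor <;> linarith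
          rw [e, mul_left_comm]
          apply mul_le_mul_of_nonneg_left _ (ind_nonneg _)
          have h3 : |XX u0 σ0 + d| ≤ |XX u0 σ0| + |d| := abs_add_le _ _
          have h4 : N * V ≤ 3 * (N * V0) := by nlinarith
          have h5 : |d| ≤ 3 * (|d| / (N * V)) * (N * V0) := by
            have : |d| = |d| / (N * V) * (N * V) := by field_simp
            have h6 : 0 ≤ |d| / (N * V) := by positivity
            nlinarith
          have h6 : 0 ≤ 3 * (|d| / (N * V)) * |XX u0 σ0| := by positivity
          have h7 := abs_nonneg (XX u0 σ0)
          nlinarith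
      _ ≤ (3 * (1 + |d| / (N * V))) * (6000000 * L) := by
          rw [Ex_mul_left]
          gcongr
      _ = _ := by ring
  refine (Ex_mono key).trans ?_
  rw [Ex_mul_left, Ex_add, Ex_const]
  simp only [div_eq_mul_inv]
  rw [Ex_mul_right, ← div_eq_mul_inv]
  have h2 := Ex_XX_abs_le u1 h1 hV hu1
  rw [← hN] at h2
  have : Ex (fun σ1 => |XX u1 σ1|) / (N * V) ≤ 1 := by
    rw [div_le_one (by positivity)]; exact h2
  nlinarith

lemma two_class (u0 u1 : Fin (M+1) → ℝ) (h0 : ∑ i, u0 i = 0) (h1 : ∑ i, u1 i = 0) {V L : ℝ} (hV : 0 < V) (hVL : V ≤ L)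
    (b : ℝ) (hu0 : ∑ i, u0 i ^ 2 ≤ V ^ 2) (hu1 : ∑ i, u1 i ^ 2 ≤ V ^ 2) (hbig : V ^ 2 / 4 ≤ ∑ i, u0 i ^ 2 + ∑ i, u1 i ^ 2) :
    Ex (fun σ0 => Ex (fun σ1 => ind (b ≤ XX u0 σ0 + XX u1 σ1 ∧ XX u0 σ0 + XX u1 σ1 ≤ b + L) *
      (|XX u0 σ0 + XX u1 σ1| + (M+1) * V))) ≤ 36000000 * L := by
  have hV2 : 0 < V^2 := by positivity
  by_cases h : V ^ 2 / 9 ≤ ∑ i, u0 i ^ 2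
  · rw [Ex_comm]
    exact two_class_aux u0 u1 h0 h1 hV hVL b hu0 hu1 h
  · have := two_class_aux u1 u0 h1 h0 hV hVL b hu1 hu0 (by linarith)
    simp only [add_comm (XX u1 _)] at this
    exact this

lemma XX_sub_const (y : Fin (M+1) → ℝ) (c : ℝ) (σ : Equiv.Perm (Fin (M+1))) : XX (fun i => y i - c) σ = XX y σ := by
  unfold XX
  simp only [mul_sub, Finset.sum_sub_distrib, ← Finset.sum_mul, sum_wt_zero]
  simp

lemma XX_smul (y : Fin (M+1) → ℝ) (c : ℝ) (σ : Equiv.Perm (Fin (M+1))) : XX (fun i => c * y i) σ = c * XX y σ := by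
  unfold XX
  rw [Finset.mul_sum]
  refine Finset.sum_congr rfl fun i _ => ?_
  ring

/-- linear weights versus XX -/
lemma lin_sum (y : Fin (M+1) → ℝ) (σ : Equiv.Perm (Fin (M+1))) (c : ℝ) :
    ∑ i : Fin (M+1), (c - 2 * (i:ℝ)) * y (σ i) = (c - M) * (∑ i, y i) - 2 * XX y σ := by
  unfold XX
  rw [← Equiv.sum_comp σ y, Finset.mul_sum, Finset.mul_sum, ← Finset.sum_sub_distrib]
  refine Finset.sum_congr rfl fun i _ => ?_
  unfold wt; ring

lemma abs_eps {ε : ℝ} (hε : ε = 1 ∨ ε = -1) : |ε| = 1 := by rcases hε with rfl | rfl <;> simp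

lemma var_shift (y : Fin (M+1) → ℝ) (c : ℝ) :
    ∑ i, (y i - c - (∑ j, (y j - c)) / (M+1)) ^ 2 = ∑ i, (y i - c) ^ 2 - (∑ j, (y j - c)) ^ 2 / (M+1) := by
  set s := ∑ j, (y j - c) with hs
  have : ∀ i, (y i - c - s / (M+1)) ^ 2 = (y i - c)^2 - 2 * (s / (M+1)) * (y i - c) + (s / (M+1))^2 := by intro i; ring
  simp only [this, Finset.sum_add_distrib, Finset.sum_sub_distrib, ← Finset.mul_sum]
  have hs' : ∑ x, y x - ∑ x : Fin (M+1), c = s := by rw [hs, Finset.sum_sub_distrib]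
  rw [hs']
  simp
  field_simp
  ring

set_option maxHeartbeats 4000000 in
lemma condB (y0 y1 : Fin (M+1) → ℝ) (ε o lam vb V : ℝ) (hε : ε = 1 ∨ ε = -1) (ho : o = 0 ∨ o = 1) (hV : 0 < V) (hM : 1 ≤ M)
    (hy0 : ∑ i, (y0 i - vb) ^ 2 ≤ V ^ 2) (hy1 : ∑ i, (y1 i - vb) ^ 2 ≤ V ^ 2)
    (hgood : V ^ 2 / 4 ≤ (∑ i, (y0 i - vb) ^ 2 - (∑ i, (y0 i - vb)) ^ 2 / (M+1)) + 
      (∑ i, (y1 i - vb) ^ 2 - (∑ i, (y1 i - vb)) ^ 2 / (M+1)))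
    (S : ℝ) (hS : S = o * vb + lam + ∑ i, y0 i + ε * ∑ i, y1 i)
    (T : Equiv.Perm (Fin (M+1)) → Equiv.Perm (Fin (M+1)) → ℝ)
    (hT : ∀ σ0 σ1, T σ0 σ1 = o * vb + lam + ∑ i : Fin (M+1), ((2 * (M+1) + o) - 2 * (i:ℝ)) * y0 (σ0 i) +
      ε * ∑ i : Fin (M+1), ((2 * (M+1) + o - 1) - 2 * (i:ℝ)) * y1 (σ1 i)) :
    Ex (fun σ0 => Ex (fun σ1 => ind (S ≠ 0 ∧ T σ0 σ1 * (T σ0 σ1 - S) ≤ 0))) ≤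
      36000000 * (16 / (2 * (M+1) + o) + 27 * ((|∑ i, (y0 i - vb)| + |∑ i, (y1 i - vb)| + |lam|) + V) / ((2 * (M+1) + o) * V)) := by
  set s0 := ∑ i, (y0 i - vb) with hs0
  set s1 := ∑ i, (y1 i - vb) with hs1
  set R := |s0| + |s1| + |lam| with hR
  have hR0 : 0 ≤ R := by positivity
  set m : ℝ := (M:ℝ) + 1 with hm
  have hM1 : (1:ℝ) ≤ M := by exact_mod_cast hM
  have hm2 : 2 ≤ m := by linarith
  set N : ℝ := 2 * m + o with hN
  have ho0 : 0 ≤ o := by rcases ho with h | h <;> rw [h] <;> norm_num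
  have ho1 : o ≤ 1 := by rcases ho with h | h <;> rw [h] <;> norm_num
  have hN4 : 4 ≤ N := by linarith
  have es0 : ∑ i, y0 i = m * vb + s0 := by rw [hs0]; simp [hm]
  have es1 : ∑ i, y1 i = m * vb + s1 := by rw [hs1]; simp [hm]
  set u0 : Fin (M+1) → ℝ := fun i => y0 i - vb - s0 / m with hu0
  set u1 : Fin (M+1) → ℝ := fun i => ε * (y1 i - vb - s1 / m) with hu1
  have hε2 : ε ^ 2 = 1 := by rcases hε with h | h <;> rw [h] <;> norm_num
  have v0 : ∑ i, u0 i ^ 2 = ∑ i, (y0 i - vb) ^ 2 - s0 ^ 2 / m := var_shift y0 vb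
  have v1 : ∑ i, u1 i ^ 2 = ∑ i, (y1 i - vb) ^ 2 - s1 ^ 2 / m := by
    rw [← var_shift y1 vb]
    refine Finset.sum_congr rfl fun i _ => ?_
    simp only [hu1, mul_pow, hε2, one_mul]
    rfl
  have z0 : ∑ i, u0 i = 0 := by
    rw [hu0, Finset.sum_sub_distrib, ← hs0]; simp; field_simp; rw [← hm]; ring
  have z1 : ∑ i, u1 i = 0 := by
    rw [hu1, ← Finset.mul_sum, Finset.sum_sub_distrib, ← hs1]; simp; right; field_simp; rw [← hm]; ring
  have X0 : ∀ σ, XX u0 σ = XX y0 σ := by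
    intro σ; rw [hu0, XX_sub_const (fun i => y0 i - vb), XX_sub_const]
  have X1 : ∀ σ, XX u1 σ = ε * XX y1 σ := by
    intro σ; rw [hu1, XX_smul, XX_sub_const (fun i => y1 i - vb), XX_sub_const]
  have q0 : 0 ≤ s0 ^ 2 / m := by positivity
  have q1 : 0 ≤ s1 ^ 2 / m := by positivity
  set μ0 : ℝ := o + (N - M) * m + ε * (N - 1 - M) * m with hμ0
  set μ' : ℝ := lam + (N - M) * s0 + ε * (N - 1 - M) * s1 with hμ'
  have hTY : ∀ σ0 σ1, T σ0 σ1 = μ0 * vb + μ' - 2 * (XX u0 σ0 + XX u1 σ1) := by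
    intro σ0 σ1
    rw [hT, lin_sum, lin_sum, es0, es1, X0, X1, hμ0, hμ', hN]; ring
  set S0 : ℝ := o + m + ε * m with hS0
  have hSS : S = S0 * vb + (lam + s0 + ε * s1) := by rw [hS, es0, es1, hS0]; ring
  set gg : ℝ := max 1 |S0| with hgg
  have hgg1 : 1 ≤ gg := le_max_left _ _
  set G := gg * |vb| with hG
  have hG0 : 0 ≤ G := by positivity
  have hεa := abs_eps hε
  have hSabs : |S| ≤ G + R := by
    rw [hSS]
    have a1 : |S0 * vb| ≤ G := by rw [abs_mul, hG]; gcongr; exact le_max_right _ _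
    have a2 : |lam + s0 + ε * s1| ≤ R := by
      have := abs_add_le (lam + s0) (ε * s1)
      have := abs_add_le lam s0
      rw [abs_mul, hεa, one_mul] at *
      linarith
    linarith [abs_add_le (S0 * vb) (lam + s0 + ε * s1)]
  have hμabs : |μ'| ≤ (N + 1) * R := by
    have := abs_add_le (lam + (N - M) * s0) (ε * (N - 1 - M) * s1)
    have := abs_add_le lam ((N - M) * s0)
    rw [abs_mul, abs_of_nonneg (by linarith : 0 ≤ N - M)] at this
    have h3 : |ε * (N - 1 - M) * s1| = (N - 1 - M) * |s1| := by
      rw [abs_mul, abs_mul, hεa, one_mul, abs_of_nonneg (by linarith : 0 ≤ N - 1 - M)]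
    have h4 : (N - M) * |s0| ≤ (N + 1) * |s0| := by gcongr; linarith
    have h5 : (N - 1 - M) * |s1| ≤ (N + 1) * |s1| := by gcongr; linarith
    have h6 : 1 * |lam| ≤ (N + 1) * |lam| := by gcongr; linarith
    rw [hμ', hR]; linarith
  have hμ0abs : N / 2 * gg ≤ |μ0| := by
    rcases hε with h | h
    · have e1 : μ0 = m * (2 * N - 2 * m + 1) + o := by rw [hμ0, h, hm]; ring
      have e2 : S0 = N := by rw [hS0, h, hN]; ring
      have e3 : gg = N := by rw [hgg, e2, abs_of_nonneg (by linarith)]; exact max_eq_right (by linarith)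
      rw [e3]
      refine le_trans ?_ (le_abs_self _)
      rw [e1, hN]; nlinarith
    · have e1 : μ0 = m + o := by rw [hμ0, h]; ring
      have e2 : S0 = o := by rw [hS0, h]; ring
      have e3 : gg = 1 := by rw [hgg, e2, abs_of_nonneg ho0]; exact max_eq_left ho1
      rw [e3]
      refine le_trans ?_ (le_abs_self _)
      rw [e1, hN]; linarith
  have hμG : N / 2 * G ≤ |μ0 * vb| := by
    rw [abs_mul, hG, ← mul_assoc]; gcongr
  set L := max (|S| / 2) V with hL
  have hVL : V ≤ L := le_max_right _ _
  have hL0 : 0 < L := by linarith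
  set b := (μ0 * vb + μ') / 2 - S / 4 - |S| / 4 with hb
  have tc := two_class u0 u1 z0 z1 hV hVL b (by linarith) (by linarith) (by rw [v0, v1]; exact hgood)
  rw [← hm] at tc
  have hTabs : ∀ t : ℝ, t * (t - S) ≤ 0 → |t - S / 2| ≤ |S| / 2 ∧ |t| ≤ |S| := by
    intro t ht
    have h1 : |t - S/2| ≤ |S / 2| := by
      apply sq_le_sq.1; nlinarith
    rw [abs_div, abs_of_pos (by norm_num : (0:ℝ) < 2)] at h1
    refine ⟨h1, ?_⟩
    have := abs_add_le (t - S/2) (S/2)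
    rw [abs_div, abs_of_pos (by norm_num : (0:ℝ) < 2), sub_add_cancel] at this
    linarith
  have hbase : ∀ ρ : ℝ, 0 < ρ → (∀ σ0 σ1, T σ0 σ1 * (T σ0 σ1 - S) ≤ 0 → ρ ≤ |XX u0 σ0 + XX u1 σ1| + m * V) →
      Ex (fun σ0 => Ex (fun σ1 => ind (S ≠ 0 ∧ T σ0 σ1 * (T σ0 σ1 - S) ≤ 0))) ≤ 36000000 * L / ρ := by
    intro ρ hρ hρ2
    rw [le_div_iff₀ hρ, ← Ex_mul_right]
    refine le_trans (Ex_mono fun σ0 => ?_) tc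
    rw [← Ex_mul_right]
    apply Ex_mono; intro σ1
    by_cases hE : S ≠ 0 ∧ T σ0 σ1 * (T σ0 σ1 - S) ≤ 0
    · have h1 := hTabs _ hE.2
      have h2 : b ≤ XX u0 σ0 + XX u1 σ1 ∧ XX u0 σ0 + XX u1 σ1 ≤ b + L := by
        have h3 := abs_le.1 h1.1
        rw [hTY] at h3
        have h4 : |S| / 2 ≤ L := le_max_left _ _
        constructor <;> linarith [h3.1, h3.2]
      rw [ind_true hE, ind_true h2, one_mul, one_mul]
      exact hρ2 _ _ hE.2
    · rw [ind_false hE, zero_mul]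
      exact mul_nonneg (ind_nonneg _) (by positivity)
  have t1 : 0 ≤ 16 / N := by positivity
  have t2 : 0 ≤ 27 * (R + V) / (N * V) := by positivity
  by_cases hcase : G ≤ 16 * (R + V)
  · refine (hbase (m * V) (by positivity) (fun σ0 σ1 _ => by linarith [abs_nonneg (XX u0 σ0 + XX u1 σ1)])).trans ?_
    have hLb : L ≤ 9 * (R + V) := max_le (by linarith) (by linarith)
    have : 36000000 * L / (m * V) ≤ 36000000 * (27 * (R + V) / (N * V)) := by
      rw [mul_div_assoc]
      gcongr 36000000 * ?_
      rw [div_le_div_iff₀ (by positivity) (by positivity)]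
      have hN3 : N ≤ 3 * m := by linarith
      calc L * (N * V) ≤ (9 * (R + V)) * (3 * m * V) := by gcongr
        _ = _ := by ring
    linarith
  · push Not at hcase
    have hGpos : 0 < G := by linarith
    refine (hbase (N * G / 16) (by positivity) ?_).trans ?_
    · intro σ0 σ1 hE
      have h1 := (hTabs _ hE).2
      have h2 : 2 * (XX u0 σ0 + XX u1 σ1) = μ0 * vb - (T σ0 σ1 - μ') := by rw [hTY]; ring
      have h3 := abs_sub_abs_le_abs_sub (μ0 * vb) (T σ0 σ1 - μ')
      have h4 := abs_add_le (T σ0 σ1) (-μ')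
      rw [abs_neg, ← sub_eq_add_neg] at h4
      rw [← h2, abs_mul 2, abs_of_pos (by norm_num : (0:ℝ) < 2)] at h3
      have h8 : 4 * G ≤ N * G := by gcongr
      have h5 : R ≤ G / 16 := by linarith
      have h6 : (N + 1) * R ≤ (N + 1) * (G / 16) := by gcongr
      have h7 : 0 ≤ m * V := by positivity
      linarith
    · have hLb : L ≤ G := max_le (by linarith) (by linarith)
      have : 36000000 * L / (N * G / 16) ≤ 36000000 * (16 / N) := by
        rw [mul_div_assoc]
        gcongr 36000000 * ?_
        rw [div_le_div_iff₀ (by positivity) (by positivity)]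
        nlinarith
      linarith

end two

open Finset Polynomial

section claimB

abbrev II (M o : ℕ) := (Fin (M+1) ⊕ Fin (M+1)) ⊕ Fin o

variable {M o : ℕ}

noncomputable def SS (ε : ℝ) (v : II M o → ℝ) (τ : Equiv.Perm (II M o)) : ℝ :=
  (∑ i, v (τ (Sum.inl (Sum.inl i)))) + ε * (∑ i, v (τ (Sum.inl (Sum.inr i)))) + ∑ j, v (τ (Sum.inr j))

noncomputable def TT (ε : ℝ) (v : II M o → ℝ) (τ : Equiv.Perm (II M o)) : ℝ :=
  (∑ i : Fin (M+1), ((2 * (M+1) + o) - 2 * (i:ℝ)) * v (τ (Sum.inl (Sum.inl i)))) +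
   ε * (∑ i : Fin (M+1), ((2 * (M+1) + o - 1) - 2 * (i:ℝ)) * v (τ (Sum.inl (Sum.inr i)))) + ∑ j, v (τ (Sum.inr j))

lemma Ex_split (F : Equiv.Perm (II M o) → ℝ) :
    Ex F = Ex (fun τ => Ex (fun σ0 => Ex (fun σ1 =>
      F (τ * (Equiv.sumCongr (Equiv.sumCongr σ0 σ1) (Equiv.refl _) : Equiv.Perm (II M o)))))) := by
  rw [Ex_comm]
  have : ∀ σ0 : Equiv.Perm (Fin (M+1)), Ex (fun τ => Ex (fun σ1 : Equiv.Perm (Fin (M+1)) =>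
      F (τ * (Equiv.sumCongr (Equiv.sumCongr σ0 σ1) (Equiv.refl _) : Equiv.Perm (II M o))))) = Ex F := by
    intro σ0
    rw [Ex_comm]
    simp only [Ex_mulRight, Ex_const]
  simp only [this, Ex_const]

lemma class_moment (v : II M o → ℝ) (hv : ∑ i, v i = 0) (w : II M o → ℝ) :
    Ex (fun τ : Equiv.Perm (II M o) => (∑ i, w i * v (τ i)) ^ 2) ≤ 2 * (∑ i, v i ^ 2) / (2 * (M+1) + o) * ∑ i, w i ^ 2 := by
  have h := full_moment_le v hv (by simp; omega) univ w
  have e : (Fintype.card (II M o) : ℝ) = 2 * (M+1) + o := by simp; ring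
  rw [e] at h
  exact h

lemma Ex_abs_le' {α : Type*} [Fintype α] [Nonempty α] (Z : α → ℝ) {B : ℝ} (hB : 0 < B)
    (h : Ex (fun x => Z x ^ 2) ≤ B ^ 2) : Ex (fun x => |Z x|) ≤ B := by
  have := Ex_abs_le (ind := fun _ => 1) (Z := Z) (fun _ => by norm_num) hB
    (by simp only [one_mul, Ex_const, mul_one]; exact h)
  simpa [Ex_const] using this

lemma claimB_const (ε : ℝ) (hε : ε = 1 ∨ ε = -1) (ho : o ≤ 1) (v : II M o → ℝ) (c : ℝ) (hc : ∀ i, v i = c)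
    (τ : Equiv.Perm (II M o)) : ¬ (SS ε v τ ≠ 0 ∧ TT ε v τ * (TT ε v τ - SS ε v τ) ≤ 0) := by
  rintro ⟨h1, h2⟩
  have l1 := lin_sum (M := M) (fun _ => c) 1 (2 * (M+1) + o)
  have l2 := lin_sum (M := M) (fun _ => c) 1 (2 * (M+1) + o - 1)
  have x0 : XX (fun _ : Fin (M+1) => c) 1 = 0 := by
    rw [← XX_sub_const (fun _ => c) c]; simp [XX]
  rw [x0] at l1 l2
  have eS : SS ε v τ = (((M:ℝ)+1) + ε * (M+1) + o) * c := by
    unfold SS; simp only [hc]; simp; ring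
  have eT : TT ε v τ = (((2 * (M+1) + o) - M) * (M+1) + ε * ((2 * (M+1) + o - 1 - M) * (M+1)) + o) * c := by
    unfold TT; simp only [hc]; rw [l1, l2]; simp; ring
  have hc2 : 0 < c ^ 2 := by
    have : c ≠ 0 := by rintro rfl; simp [eS] at h1
    positivity
  have hM0 : (0:ℝ) ≤ M := by positivity
  have ho' : (o:ℝ) = 0 ∨ (o:ℝ) = 1 := by
    interval_cases o <;> simp
  rw [eS, eT] at h2
  set A := (((2 * ((M:ℝ)+1) + o) - M) * (M+1) + ε * ((2 * (M+1) + o - 1 - M) * (M+1)) + o) with hA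
  set B := (((M:ℝ)+1) + ε * (M+1) + o) with hB
  have h3 : c ^ 2 * (A * (A - B)) ≤ 0 := by linarith [h2, (by ring : c ^ 2 * (A * (A - B)) = A * c * (A * c - B * c))]
  have h4 : 0 < A ∧ 0 < A - B := by
    rw [hA, hB]
    rcases hε with h | h <;> rcases ho' with h' | h' <;> rw [h, h'] <;> constructor <;> nlinarith
  have := mul_pos hc2 (mul_pos h4.1 h4.2)
  linarith

lemma sq_sum_small (ho : o ≤ 1) (f : Fin o → ℝ) : (∑ j, f j) ^ 2 = ∑ j, f j ^ 2 := by
  interval_cases o <;> simp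

set_option maxHeartbeats 1000000 in
theorem claimB (ε : ℝ) (hε : ε = 1 ∨ ε = -1) (ho : o ≤ 1) (v : II M o → ℝ) :
    Ex (fun τ => ind (SS ε v τ ≠ 0 ∧ TT ε v τ * (TT ε v τ - SS ε v τ) ≤ 0)) ≤ 5000000000 / (2 * (M+1) + o) := by
  have ho' : (o:ℝ) = 0 ∨ (o:ℝ) = 1 := by
    interval_cases o <;> simp
  have ho1 : (o:ℝ) ≤ 1 := by exact_mod_cast ho
  have ho0 : (0:ℝ) ≤ o := by positivity
  rcases Nat.eq_zero_or_pos M with h0 | hM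
  · subst h0
    refine (Ex_mono (g := fun _ => 1) (fun τ => ind_le_one _)).trans ?_
    rw [Ex_const, le_div_iff₀ (by positivity)]
    simp; linarith
  set N : ℝ := 2 * ((M:ℝ)+1) + o with hN
  have hN0 : 0 < N := by positivity
  set vb := (∑ i, v i) / N with hvb
  set v' : II M o → ℝ := fun i => v i - vb with hv'
  have hsum : ∑ i, v' i = 0 := by
    have e : ∑ i : II M o, vb = N * vb := by
      simp [hN]; left; ring
    rw [hv', Finset.sum_sub_distrib, e, hvb]; field_simp; ring
  by_cases hVV : ∑ i, v' i ^ 2 = 0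
  · have hc : ∀ i, v i = vb := by
      intro i
      have := (Finset.sum_eq_zero_iff_of_nonneg (fun i _ => sq_nonneg _)).1 hVV i (mem_univ _)
      have := pow_eq_zero_iff (two_ne_zero) |>.1 this
      rw [hv'] at this; simp only at this; linarith
    refine (Ex_mono (g := fun _ => 0) (fun τ => ?_)).trans ?_
    · rw [ind_false (claimB_const ε hε ho v vb hc τ)]
    · rw [Ex_const]; positivity
  have hVp : 0 < ∑ i, v' i ^ 2 := lt_of_le_of_ne (Finset.sum_nonneg fun i _ => sq_nonneg _) (Ne.symm hVV)
  set V := √(∑ i, v' i ^ 2) with hV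
  have hV0 : 0 < V := Real.sqrt_pos.2 hVp
  have hV2 : V ^ 2 = ∑ i, v' i ^ 2 := Real.sq_sqrt hVp.le
  set m : ℝ := (M:ℝ) + 1 with hm
  have hm0 : 0 < m := by positivity
  set s0 : Equiv.Perm (II M o) → ℝ := fun τ => ∑ i, v' (τ (Sum.inl (Sum.inl i))) with hs0
  set s1 : Equiv.Perm (II M o) → ℝ := fun τ => ∑ i, v' (τ (Sum.inl (Sum.inr i))) with hs1
  set lam : Equiv.Perm (II M o) → ℝ := fun τ => ∑ j, v' (τ (Sum.inr j)) with hlam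
  have m0 : Ex (fun τ => s0 τ ^ 2) ≤ 2 * V ^ 2 / N * m := by
    have h := class_moment v' hsum (Sum.elim (Sum.elim (fun _ => 1) (fun _ => 0)) (fun _ => 0))
    rw [← hV2] at h
    simpa [Fintype.sum_sum_type] using h
  have m1 : Ex (fun τ => s1 τ ^ 2) ≤ 2 * V ^ 2 / N * m := by
    have h := class_moment v' hsum (Sum.elim (Sum.elim (fun _ => 0) (fun _ => 1)) (fun _ => 0))
    rw [← hV2] at h
    simpa [Fintype.sum_sum_type] using h
  have ml : Ex (fun τ => lam τ ^ 2) ≤ 2 * V ^ 2 / N * o := by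
    have h := class_moment v' hsum (Sum.elim (Sum.elim (fun _ => 0) (fun _ => 0)) (fun _ => 1))
    rw [← hV2] at h
    simpa [Fintype.sum_sum_type] using h
  have hle : ∀ t : ℝ, t ≤ m → 2 * V ^ 2 / N * t ≤ V ^ 2 := by
    intro t ht
    rw [div_mul_eq_mul_div, div_le_iff₀ hN0]
    have : 2 * t ≤ N := by linarith
    have hV2' : 0 ≤ V ^ 2 := by positivity
    nlinarith
  have hm1 : (1:ℝ) ≤ m := by rw [hm]; linarith [(by positivity : (0:ℝ) ≤ M)]
  have a0 : Ex (fun τ => |s0 τ|) ≤ V := Ex_abs_le' _ hV0 (m0.trans (hle m le_rfl))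
  have a1 : Ex (fun τ => |s1 τ|) ≤ V := Ex_abs_le' _ hV0 (m1.trans (hle m le_rfl))
  have al : Ex (fun τ => |lam τ|) ≤ V := Ex_abs_le' _ hV0 (ml.trans (hle o (by linarith)))
  set Z : Equiv.Perm (II M o) → ℝ := fun τ => lam τ ^ 2 + s0 τ ^ 2 * m⁻¹ + s1 τ ^ 2 * m⁻¹ with hZ
  have hZ0 : ∀ τ, 0 ≤ Z τ := by intro τ; rw [hZ]; positivity
  have EZ : Ex Z ≤ 6 * V ^ 2 / N := by
    rw [hZ, Ex_add, Ex_add, Ex_mul_right, Ex_mul_right]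
    have b0 : Ex (fun τ => s0 τ ^ 2) * m⁻¹ ≤ 2 * V ^ 2 / N := by
      calc _ ≤ 2 * V ^ 2 / N * m * m⁻¹ := by gcongr
        _ = _ := by field_simp
    have b1 : Ex (fun τ => s1 τ ^ 2) * m⁻¹ ≤ 2 * V ^ 2 / N := by
      calc _ ≤ 2 * V ^ 2 / N * m * m⁻¹ := by gcongr
        _ = _ := by field_simp
    have bl : Ex (fun τ => lam τ ^ 2) ≤ 2 * V ^ 2 / N * 1 := by
      refine ml.trans ?_; gcongr
    have : 6 * V ^ 2 / N = 3 * (2 * V ^ 2 / N) := by ring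
    linarith
  have hbad : Ex (fun τ => ind (3 * V ^ 2 / 4 ≤ Z τ)) ≤ 8 / N := by
    refine (Ex_ind_le hZ0 (by positivity)).trans ?_
    calc _ ≤ (6 * V ^ 2 / N) / (3 * V ^ 2 / 4) := by gcongr
      _ = _ := by field_simp; norm_num
  rw [Ex_split]
  have key : ∀ τ : Equiv.Perm (II M o), Ex (fun σ0 => Ex (fun σ1 => (fun τ => ind (SS ε v τ ≠ 0 ∧ TT ε v τ * (TT ε v τ - SS ε v τ) ≤ 0))
      (τ * (Equiv.sumCongr (Equiv.sumCongr σ0 σ1) (Equiv.refl _) : Equiv.Perm (II M o))))) ≤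
      ind (3 * V ^ 2 / 4 ≤ Z τ) + (36000000 * (16 / N + 27 / N) + 36000000 * 27 / (N * V) * (|s0 τ| + |s1 τ| + |lam τ|)) := by
    intro τ
    by_cases hb : 3 * V ^ 2 / 4 ≤ Z τ
    · rw [ind_true hb]
      have : Ex (fun σ0 => Ex (fun σ1 => (fun τ => ind (SS ε v τ ≠ 0 ∧ TT ε v τ * (TT ε v τ - SS ε v τ) ≤ 0))
      (τ * (Equiv.sumCongr (Equiv.sumCongr σ0 σ1) (Equiv.refl _) : Equiv.Perm (II M o))))) ≤ 1 := by
        refine (Ex_mono (g := fun _ => 1) fun σ0 => (Ex_mono (g := fun _ => 1) fun σ1 => ind_le_one _).trans ?_).trans ?_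
        · rw [Ex_const]
        · rw [Ex_const]
      have h2 : 0 ≤ (36000000 * (16 / N + 27 / N) + 36000000 * 27 / (N * V) * (|s0 τ| + |s1 τ| + |lam τ|)) := by positivity
      linarith
    rw [ind_false hb, zero_add]
    push Not at hb
    set y0 : Fin (M+1) → ℝ := fun i => v (τ (Sum.inl (Sum.inl i))) with hy0
    set y1 : Fin (M+1) → ℝ := fun i => v (τ (Sum.inl (Sum.inr i))) with hy1
    have hVs : V ^ 2 = ∑ i, (y0 i - vb) ^ 2 + ∑ i, (y1 i - vb) ^ 2 + lam τ ^ 2 := by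
      have hl : lam τ ^ 2 = ∑ j, v' (τ (Sum.inr j)) ^ 2 := by
        exact sq_sum_small ho _
      rw [hl, hV2, ← Equiv.sum_comp τ (fun i => v' i ^ 2), Fintype.sum_sum_type, Fintype.sum_sum_type]
    have hol : o * vb + lam τ = ∑ j, v (τ (Sum.inr j)) := by
      simp only [hlam, hv', Finset.sum_sub_distrib]; simp
    have p0 : 0 ≤ ∑ i, (y0 i - vb) ^ 2 := Finset.sum_nonneg fun i _ => sq_nonneg _
    have p1 : 0 ≤ ∑ i, (y1 i - vb) ^ 2 := Finset.sum_nonneg fun i _ => sq_nonneg _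
    have pl := sq_nonneg (lam τ)
    have cB := condB y0 y1 ε o (lam τ) vb V hε ho' hV0 hM (by linarith) (by linarith)
      (by
        have e0 : ∑ i, (y0 i - vb) = s0 τ := rfl
        have e1 : ∑ i, (y1 i - vb) = s1 τ := rfl
        rw [e0, e1, ← hm, div_eq_mul_inv _ m, div_eq_mul_inv _ m]
        simp only [hZ] at hb
        linarith) _ rfl _ (fun _ _ => rfl)
    have e0 : ∑ i, (y0 i - vb) = s0 τ := rfl
    have e1 : ∑ i, (y1 i - vb) = s1 τ := rfl
    rw [e0, e1, ← hm, ← hN, hol] at cB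
    have hSS : ∀ σ0 σ1, SS ε v (τ * (Equiv.sumCongr (Equiv.sumCongr σ0 σ1) (Equiv.refl _) : Equiv.Perm (II M o))) =
        ∑ j, v (τ (Sum.inr j)) + ∑ i, y0 i + ε * ∑ i, y1 i := by
      intro σ0 σ1
      unfold SS
      rw [← Equiv.sum_comp σ0 y0, ← Equiv.sum_comp σ1 y1]
      simp only [Equiv.Perm.mul_apply, Equiv.sumCongr_apply, Sum.map_inl, Sum.map_inr, Equiv.refl_apply, hy0, hy1]
      ring
    have hTT : ∀ σ0 σ1, TT ε v (τ * (Equiv.sumCongr (Equiv.sumCongr σ0 σ1) (Equiv.refl _) : Equiv.Perm (II M o))) =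
        ∑ j, v (τ (Sum.inr j)) + ∑ i : Fin (M+1), (N - 2 * (i:ℝ)) * y0 (σ0 i) +
      ε * ∑ i : Fin (M+1), (N - 1 - 2 * (i:ℝ)) * y1 (σ1 i) := by
      intro σ0 σ1
      unfold TT
      simp only [Equiv.Perm.mul_apply, Equiv.sumCongr_apply, Sum.map_inl, Sum.map_inr, Equiv.refl_apply, hy0, hy1, hN, hm]
      ring
    simp only [hSS, hTT]
    refine cB.trans (le_of_eq ?_)
    field_simp
    ring
  refine (Ex_mono key).trans ?_
  rw [Ex_add, Ex_add, Ex_const, Ex_mul_left, Ex_add, Ex_add]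
  have : 36000000 * 27 / (N * V) * (Ex (fun τ => |s0 τ|) + Ex (fun τ => |s1 τ|) + Ex (fun τ => |lam τ|)) ≤
      36000000 * 27 / (N * V) * (V + V + V) := by gcongr
  have e : 36000000 * 27 / (N * V) * (V + V + V) = 36000000 * 27 * 3 * (1 / N) := by field_simp; norm_num
  have e2 : (5000000000:ℝ) / N = 5000000000 * (1 / N) := by ring
  have e3 : (36000000:ℝ) * (16 / N + 27 / N) = 36000000 * 43 * (1 / N) := by ring
  have e4 : (8:ℝ) / N = 8 * (1 / N) := by ring
  have e5 : 0 ≤ 1 / N := by positivity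
  rw [e3, e2]
  rw [e4] at hbad
  linarith

end claimB

open Finset Polynomial

section transfer

/-- partial sums -/
noncomputable def pS (a : ℕ → ℝ) (k : ℕ) : ℝ := ∑ j ∈ range (k+1), a j
noncomputable def pT (a : ℕ → ℝ) (k : ℕ) : ℝ := ∑ j ∈ range (k+1), pS a j

def EE (a : ℕ → ℝ) (k : ℕ) : Prop := pS a k ≠ 0 ∧ pT a k * (pT a k - pS a k) ≤ 0

lemma pT_eq (a : ℕ → ℝ) (k : ℕ) : pT a k = ∑ j ∈ range (k+1), ((k:ℝ) + 1 - j) * a j := by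
  induction k with
  | zero => simp [pT, pS]
  | succ k ih =>
    unfold pT at *
    rw [Finset.sum_range_succ, ih, Finset.sum_range_succ _ (k+1), pS, Finset.sum_range_succ _ (k+1)]
    rw [← add_assoc, ← Finset.sum_add_distrib]
    push_cast
    congr 1
    · refine Finset.sum_congr rfl fun j _ => ?_
      ring
    · ring

lemma sum_parity (m o : ℕ) (ho : o ≤ 1) (f : ℕ → ℝ) :
    ∑ j ∈ range (2 * m + o), f j = (∑ i : Fin m, f (2 * i)) + (∑ i : Fin m, f (2 * i + 1)) + ∑ _j : Fin o, f (2 * m) := by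
  have h : ∑ j ∈ range (2 * m), f j = (∑ i : Fin m, f (2 * i)) + (∑ i : Fin m, f (2 * i + 1)) := by
    rw [Fin.sum_univ_eq_sum_range (fun i => f (2 * i)), Fin.sum_univ_eq_sum_range (fun i => f (2 * i + 1))]
    induction m with
    | zero => simp
    | succ m ih =>
      rw [Nat.mul_succ, Finset.sum_range_succ, Finset.sum_range_succ, ih, Finset.sum_range_succ _ m, Finset.sum_range_succ _ m]
      ring
  rw [← h]
  interval_cases o
  · simp
  · simp [Finset.sum_range_succ]

noncomputable def sqn {n : ℕ} (ε : ℝ) (u : Fin (n+1) → ℝ) (π : Equiv.Perm (Fin (n+1))) (j : ℕ) : ℝ :=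
  if h : j < n + 1 then ε ^ j * u (π ⟨j, h⟩) else 0

lemma sqn_lt {n : ℕ} (ε : ℝ) (u : Fin (n+1) → ℝ) (π : Equiv.Perm (Fin (n+1))) (j : Fin (n+1)) :
    sqn ε u π j = ε ^ (j:ℕ) * u (π j) := by
  unfold sqn; rw [dif_pos j.2]

def gfun {n M o : ℕ} (ho : o ≤ 1) (h : 2 * (M+1) + o ≤ n + 1) : II M o ↪ Fin (n+1) where
  toFun x := match x with
    | Sum.inl (Sum.inl i) => ⟨2 * i, by omega⟩
    | Sum.inl (Sum.inr i) => ⟨2 * i + 1, by omega⟩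
    | Sum.inr j => ⟨2 * (M+1), by have := j.2; omega⟩
  inj' := by
    rintro ((i | i) | i) ((j | j) | j) hij <;> simp only [Fin.mk.injEq] at hij
    all_goals first
      | omega
      | (congr 2; apply Fin.ext; omega)
      | (congr 1; apply Fin.ext; omega)

lemma transfer_aux {n M o : ℕ} (ho : o ≤ 1) (h : 2 * (M+1) + o ≤ n + 1) (ε : ℝ) (hε : ε = 1 ∨ ε = -1) (u : Fin (n+1) → ℝ) :
    Ex (fun π => ind (EE (sqn ε u π) (2 * M + 1 + o))) ≤ 5000000000 / (2 * (M+1) + o) := by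
  set g := gfun ho h with hg
  have hE : Ex (fun π => ind (EE (sqn ε u π) (2 * M + 1 + o))) =
      Ex (fun π : Equiv.Perm (Fin (n+1)) => Ex (fun τ : Equiv.Perm (II M o) => ind (EE (sqn ε u (π * Equiv.Perm.viaFintypeEmbedding τ g)) (2 * M + 1 + o)))) := by
    rw [Ex_comm]
    have : ∀ τ : Equiv.Perm (II M o), Ex (fun π : Equiv.Perm (Fin (n+1)) => ind (EE (sqn ε u (π * Equiv.Perm.viaFintypeEmbedding τ g)) (2 * M + 1 + o)))
      = Ex (fun π => ind (EE (sqn ε u π) (2 * M + 1 + o))) := fun τ =>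
        Ex_mulRight (Equiv.Perm.viaFintypeEmbedding τ g) (fun π => ind (EE (sqn ε u π) (2 * M + 1 + o)))
    simp only [this, Ex_const]
  rw [hE]
  refine (Ex_mono (g := fun _ => 5000000000 / (2 * ((M:ℝ)+1) + o)) fun π => ?_).trans (le_of_eq (Ex_const _))
  refine le_trans (Ex_mono fun τ => ?_) (claimB ε hε ho (fun x => u (π (g x))))
  have hε2 : ∀ i : ℕ, ε ^ (2 * i) = 1 := by
    intro i; rw [pow_mul]; rcases hε with h | h <;> simp [h]
  have hsq : ∀ x : II M o, sqn ε u (π * Equiv.Perm.viaFintypeEmbedding τ g) (g x) = ε ^ ((g x : Fin (n+1)) : ℕ) * u (π (g (τ x))) := by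
    intro x
    rw [sqn_lt, Equiv.Perm.mul_apply, Equiv.Perm.viaFintypeEmbedding_apply_image]
  set a := sqn ε u (π * Equiv.Perm.viaFintypeEmbedding τ g) with ha
  have q0 : ∀ i : Fin (M+1), a (2 * i) = u (π (g (τ (Sum.inl (Sum.inl i))))) := by
    intro i; have := hsq (Sum.inl (Sum.inl i))
    change a (2 * i) = ε ^ (2 * (i:ℕ)) * _ at this
    rw [this, hε2, one_mul]
  have q1 : ∀ i : Fin (M+1), a (2 * i + 1) = ε * u (π (g (τ (Sum.inl (Sum.inr i))))) := by
    intro i; have := hsq (Sum.inl (Sum.inr i))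
    change a (2 * i + 1) = ε ^ (2 * (i:ℕ) + 1) * _ at this
    rw [this, pow_succ, hε2, one_mul]
  have q2 : ∀ i : Fin o, a (2 * (M+1)) = u (π (g (τ (Sum.inr i)))) := by
    intro i; have := hsq (Sum.inr i)
    change a (2 * (M+1)) = ε ^ (2 * (M+1)) * _ at this
    rw [this, hε2, one_mul]
  have eN : 2 * M + 1 + o + 1 = 2 * (M+1) + o := by ring
  have eS : pS a (2 * M + 1 + o) = SS ε (fun x => u (π (g x))) τ := by
    unfold pS SS
    rw [eN, sum_parity _ _ ho, Finset.mul_sum]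
    simp only [q0, q1]
    congr 1
    exact Finset.sum_congr rfl fun j _ => q2 j
  have eT : pT a (2 * M + 1 + o) = TT ε (fun x => u (π (g x))) τ := by
    rw [pT_eq]
    unfold TT
    rw [eN, sum_parity _ _ ho, Finset.mul_sum]
    congr 1
    · congr 1
      · refine Finset.sum_congr rfl fun i _ => ?_
        rw [q0]; push_cast; ring
      · refine Finset.sum_congr rfl fun i _ => ?_
        rw [q1]; push_cast; ring
    · refine Finset.sum_congr rfl fun j _ => ?_
      have ho1 : (o:ℝ) = 1 := by
        have := j.2
        have : o = 1 := by omega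
        rw [this]; simp
      rw [q2 j]; push_cast; rw [ho1]; ring
  unfold EE
  rw [eS, eT]

lemma prob_EE {n k : ℕ} (hk : 1 ≤ k) (hkn : k ≤ n) (ε : ℝ) (hε : ε = 1 ∨ ε = -1) (u : Fin (n+1) → ℝ) :
    Ex (fun π => ind (EE (sqn ε u π) k)) ≤ 5000000000 / (k + 1) := by
  obtain ⟨M, o, ho, rfl⟩ : ∃ M o, o ≤ 1 ∧ k = 2 * M + 1 + o := ⟨(k-1)/2, (k-1)%2, by omega, by omega⟩
  refine (transfer_aux ho (by omega) ε hε u).trans (le_of_eq ?_)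
  push_cast; ring

end transfer

open Finset Polynomial

section descartes

def Vv (c : ℕ → ℝ) (k : ℕ) : Prop := c k ≠ c (k+1) ∧ c k * c (k+1) ≤ 0

open scoped Classical in
noncomputable def WCt (c : ℕ → ℝ) (D : ℕ) : ℕ := ((range D).filter (Vv c)).card

lemma WCt_mono (c : ℕ → ℝ) {D D' : ℕ} (h : D ≤ D') : WCt c D ≤ WCt c D' := by
  classical
  exact Finset.card_le_card (Finset.filter_subset_filter _ (Finset.range_mono h))

lemma WCt_congr {c c' : ℕ → ℝ} {D : ℕ} (h : ∀ k ≤ D, c k = c' k) : WCt c D = WCt c' D := by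
  classical
  unfold WCt
  congr 1
  apply Finset.filter_congr
  intro k hk
  rw [Finset.mem_range] at hk
  unfold Vv
  rw [h k hk.le, h (k+1) hk]

lemma WCt_neg (c : ℕ → ℝ) (D : ℕ) : WCt (fun k => - c k) D = WCt c D := by
  classical
  unfold WCt
  congr 1
  apply Finset.filter_congr
  intro k _
  unfold Vv
  simp

lemma WCt_succ_of {c : ℕ → ℝ} {D : ℕ} (h : Vv c D) : WCt c (D+1) = WCt c D + 1 := by
  classical
  unfold WCt
  rw [Finset.range_add_one, Finset.filter_insert, if_pos h, Finset.card_insert_of_notMem (by simp)]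

lemma sv_le : ∀ (d : ℕ) (Q : ℝ[X]), Q.natDegree ≤ d → Q.signVariations ≤ WCt Q.coeff Q.natDegree := by
  intro d
  induction d with
  | zero =>
    intro Q hQ
    have h := Polynomial.eq_C_of_natDegree_le_zero hQ
    rw [h, ← monomial_zero_left, signVariations_monomial]
    exact Nat.zero_le _
  | succ d ih =>
    intro Q hQ
    by_cases h0 : Q.natDegree = 0
    · exact (by
        have h := Polynomial.eq_C_of_natDegree_eq_zero h0
        rw [h, ← monomial_zero_left, signVariations_monomial]
        exact Nat.zero_le _)
    have hQ0 : Q ≠ 0 := by rintro rfl; simp at h0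
    obtain ⟨e, he⟩ := Nat.exists_eq_succ_of_ne_zero h0
    have hR : Q.eraseLead.natDegree ≤ e := by
      have := eraseLead_natDegree_le Q; omega
    have ihR := ih Q.eraseLead (by omega)
    have hc : ∀ k ≤ e, Q.eraseLead.coeff k = Q.coeff k := by
      intro k hk
      rw [eraseLead_coeff_of_ne]; omega
    have h1 : WCt Q.eraseLead.coeff Q.eraseLead.natDegree ≤ WCt Q.coeff e := by
      rw [WCt_congr (c' := Q.coeff) (fun k hk => hc k (by omega))]
      exact WCt_mono _ hR
    rw [signVariations_eq_eraseLead_add_ite hQ0, he]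
    split_ifs with hs
    · have hlead : Q.leadingCoeff ≠ 0 := leadingCoeff_ne_zero.2 hQ0
      have hv : Vv Q.coeff e := by
        have hl : Q.coeff (e+1) = Q.leadingCoeff := by rw [leadingCoeff, he]
        have hprod : Q.coeff e * Q.leadingCoeff ≤ 0 := by
          rcases hR.lt_or_eq with hlt | heq
          · rw [← hc e le_rfl, coeff_eq_zero_of_natDegree_lt hlt, zero_mul]
          · rw [← hc e le_rfl]
            have : Q.eraseLead.coeff e = Q.eraseLead.leadingCoeff := by rw [leadingCoeff, heq]
            rw [this]
            rcases lt_or_gt_of_ne hlead with hneg | hpos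
            · rw [sign_neg hneg] at hs
              have : SignType.sign Q.eraseLead.leadingCoeff = 1 := by
                generalize SignType.sign Q.eraseLead.leadingCoeff = t at hs
                revert hs; cases t <;> decide
              have := sign_eq_one_iff.1 this
              nlinarith
            · rw [sign_pos hpos] at hs
              have : SignType.sign Q.eraseLead.leadingCoeff = -1 := by
                generalize SignType.sign Q.eraseLead.leadingCoeff = t at hs
                revert hs; cases t <;> decide
              have := sign_eq_neg_one_iff.1 this
              nlinarith
        refine ⟨?_, ?_⟩
        · intro h
          rw [hl] at h
          rw [h] at hprod
          have := mul_self_pos.2 hlead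
          linarith
        · rw [hl]; exact hprod
      rw [Nat.succ_eq_add_one, WCt_succ_of hv]; omega
    · have := WCt_mono Q.coeff (Nat.le_succ e); omega

noncomputable def posr (P : ℝ[X]) : ℕ := P.roots.countP (fun x => 0 < x)

lemma posr_le (Q : ℝ[X]) (D : ℕ) (h : Q.natDegree ≤ D) : posr Q ≤ WCt Q.coeff D :=
  (roots_countP_pos_le_signVariations Q).trans ((sv_le _ Q le_rfl).trans (WCt_mono _ h))

noncomputable def geom (L : ℕ) : ℝ[X] := ∑ i ∈ range (L+1), X ^ i

lemma geom_coeff (L k : ℕ) : (geom L).coeff k = if k ≤ L then 1 else 0 := by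
  unfold geom
  simp [coeff_X_pow]

lemma geom_natDegree (L : ℕ) : (geom L).natDegree ≤ L := by
  rw [natDegree_le_iff_coeff_eq_zero]
  intro k hk
  rw [geom_coeff, if_neg (by omega)]

lemma geom_ne (L : ℕ) : geom L ≠ 0 := by
  intro h
  have := geom_coeff L 0
  rw [h] at this
  simp at this

lemma geom_reflect (L : ℕ) : reflect L (geom L) = geom L := by
  ext k
  rw [coeff_reflect, geom_coeff, geom_coeff]
  rcases le_or_gt k L with h | h
  · rw [revAt_le h, if_pos (by omega), if_pos h]
  · rw [revAt_eq_self_of_lt h]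

lemma mul_geom_coeff (Q : ℝ[X]) (L k : ℕ) : (Q * geom L).coeff k = ∑ i ∈ range (L+1), if i ≤ k then Q.coeff (k-i) else 0 := by
  unfold geom
  rw [Finset.mul_sum, finsetSum_coeff]
  refine Finset.sum_congr rfl fun i _ => ?_
  rw [coeff_mul_X_pow']

lemma mul_geom_coeff_le (Q : ℝ[X]) {L k : ℕ} (h : k ≤ L) : (Q * geom L).coeff k = pS Q.coeff k := by
  rw [mul_geom_coeff]
  unfold pS
  rw [← Finset.sum_range_reflect (fun j => Q.coeff j) (k+1), ← Finset.sum_filter]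
  have : (range (L+1)).filter (fun i => i ≤ k) = range (k+1) := by
    ext i; simp; omega
  rw [this]
  refine Finset.sum_congr rfl fun i _ => ?_
  rfl

lemma mul_geom_abs (Q : ℝ[X]) (n L k : ℕ) (h : Q.natDegree ≤ n) : |(Q * geom L).coeff k| ≤ ∑ i ∈ range (n+1), |Q.coeff i| := by
  rw [mul_geom_coeff]
  refine (Finset.abs_sum_le_sum_abs _ _).trans ?_
  calc _ = ∑ i ∈ (range (L+1)).filter (fun i => i ≤ k), |Q.coeff (k-i)| := by
        rw [Finset.sum_filter]
        refine Finset.sum_congr rfl fun i _ => ?_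
        split_ifs <;> simp
    _ ≤ ∑ i ∈ range (k+1), |Q.coeff (k-i)| := by
        apply Finset.sum_le_sum_of_subset_of_nonneg
        · intro i; simp
        · intros; positivity
    _ = ∑ i ∈ range (k+1), |Q.coeff i| := by
        rw [← Finset.sum_range_reflect (fun i => |Q.coeff i|)]
        refine Finset.sum_congr rfl fun i _ => ?_
        rfl
    _ ≤ ∑ i ∈ range (max n k + 1), |Q.coeff i| := by
        apply Finset.sum_le_sum_of_subset_of_nonneg
        · apply Finset.range_mono; omega
        · intros; positivity
    _ = _ := by
        symm
        apply Finset.sum_subset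
        · apply Finset.range_mono; omega
        · intro i _ hi
          rw [Finset.mem_range] at hi
          rw [coeff_eq_zero_of_natDegree_lt (by omega), abs_zero]

lemma posr_mul_le {P K : ℝ[X]} (hP : P ≠ 0) (hK : K ≠ 0) : posr P ≤ posr (P * K) :=
  Multiset.countP_le_of_le _ (roots.le_of_dvd (mul_ne_zero hP hK) (dvd_mul_right _ _))

lemma WCt_split (c : ℕ → ℝ) (d : ℕ) : WCt c (d+d) ≤ WCt c d + WCt (fun k => c (d+d-k)) d := by
  classical
  unfold WCt
  rw [Finset.range_eq_Ico, ← Finset.Ico_union_Ico_eq_Ico (Nat.zero_le d) (Nat.le_add_left d d), Finset.filter_union]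
  refine (Finset.card_union_le _ _).trans ?_
  rw [← Finset.range_eq_Ico]
  refine Nat.add_le_add_left ?_ _
  apply Finset.card_le_card_of_injOn (fun k => d + d - 1 - k)
  · intro k hk
    simp only [Finset.coe_filter, Finset.mem_Ico, Set.mem_ofPred_eq, Finset.mem_range] at hk ⊢
    obtain ⟨⟨h1, h2⟩, h3⟩ := hk
    refine ⟨by omega, ?_⟩
    unfold Vv at *
    have e1 : d + d - (d + d - 1 - k) = k + 1 := by omega
    have e2 : d + d - (d + d - 1 - k + 1) = k := by omega
    simp only [e1, e2]
    exact ⟨h3.1.symm, by rw [mul_comm]; exact h3.2⟩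
  · intro k hk l hl hkl
    simp only [Finset.coe_filter, Finset.mem_Ico, Set.mem_ofPred_eq, Finset.mem_range] at hk hl hkl
    omega

lemma lemG (Q : ℝ[X]) (hQ : Q ≠ 0) (d : ℕ) (hd : Q.natDegree ≤ d) :
    posr Q ≤ WCt (pS Q.coeff) d + WCt (pS (reflect d Q).coeff) d := by
  refine (posr_mul_le hQ (geom_ne d)).trans ?_
  refine (posr_le _ (d+d) (natDegree_mul_le.trans (Nat.add_le_add hd (geom_natDegree d)))).trans ?_
  refine (WCt_split _ d).trans (le_of_eq ?_)
  congr 1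
  · exact WCt_congr fun k hk => mul_geom_coeff_le Q hk
  · refine WCt_congr fun k hk => ?_
    rw [← mul_geom_coeff_le _ hk]
    nth_rewrite 2 [← geom_reflect]
    rw [← reflect_mul _ _ hd (geom_natDegree d), coeff_reflect, revAt_le (by omega)]

lemma pS_succ (a : ℕ → ℝ) (k : ℕ) : pS a (k+1) = pS a k + a (k+1) := Finset.sum_range_succ _ _
lemma pT_succ (a : ℕ → ℝ) (k : ℕ) : pT a (k+1) = pT a k + pS a (k+1) := Finset.sum_range_succ _ _

lemma pS_of_mul (P R : ℝ[X]) (h : P = (X - C 1) * R) (k : ℕ) : R.coeff k = - pS P.coeff k := by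
  induction k with
  | zero => rw [h]; simp [pS, sub_mul]
  | succ k ih =>
    rw [pS_succ, neg_add, ← ih, h, sub_mul, coeff_sub, coeff_X_mul, C_1, one_mul]; ring

lemma pS_neg (a : ℕ → ℝ) : pS (fun k => - a k) = fun k => - pS a k := by
  ext k; simp [pS]

lemma case0 (P : ℝ[X]) (hP : P ≠ 0) (n : ℕ) (hn : 1 ≤ n) (hd : P.natDegree ≤ n) (h1 : P.eval 1 = 0) :
    posr P ≤ WCt (pT P.coeff) n + WCt (pT (reflect n P).coeff) n + 1 := by
  obtain ⟨Q, hQ⟩ := dvd_iff_isRoot.2 (show P.IsRoot 1 from h1)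
  have hQ0 : Q ≠ 0 := by rintro rfl; simp at hQ; exact hP hQ
  have hdQ : Q.natDegree ≤ n - 1 := by
    have := natDegree_mul (X_sub_C_ne_zero (1:ℝ)) hQ0
    rw [← hQ, natDegree_X_sub_C] at this; omega
  have e1 : posr P = posr Q + 1 := by
    unfold posr
    have hne := hP
    rw [hQ] at hne ⊢
    rw [roots_mul hne, roots_X_sub_C, Multiset.countP_add]
    simp [add_comm, Multiset.countP_eq_card_filter, Multiset.filter_singleton]
  have hG := lemG Q hQ0 (n-1) hdQ
  have c1 : Q.coeff = fun k => - pS P.coeff k := funext fun k => pS_of_mul P Q hQ k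
  have hR : reflect n P = (X - C 1) * (- reflect (n-1) Q) := by
    have : n = 1 + (n - 1) := by omega
    have hX : reflect 1 (X - C 1 : ℝ[X]) = -(X - C 1) := by
      ext k
      rw [coeff_reflect]
      rcases k with _ | _ | k
      · rw [revAt_le (by omega)]; simp [coeff_X, coeff_one]
      · rw [revAt_le (by omega)]; simp [coeff_X, coeff_one]
      · rw [revAt_eq_self_of_lt (by omega)]; simp [coeff_X, coeff_one]
    conv_lhs => rw [this, hQ]
    rw [reflect_mul _ _ (natDegree_X_sub_C_le _) hdQ, hX]; ring
  have c2 : (reflect (n-1) Q).coeff = fun k => pS (reflect n P).coeff k := funext fun k => by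
    have := pS_of_mul _ _ hR k
    rw [coeff_neg] at this; linarith
  rw [c1, c2, pS_neg, WCt_neg] at hG
  have w1 : WCt (pS (pS P.coeff)) (n-1) ≤ WCt (pT P.coeff) n := WCt_mono _ (by omega)
  have w2 : WCt (pS (fun k => pS (reflect n P).coeff k)) (n-1) ≤ WCt (pT (reflect n P).coeff) n := WCt_mono _ (by omega)
  omega

lemma lin_events (c : ℕ → ℝ) (s : ℝ) (hs : s ≠ 0) (n M d : ℕ) (hnM : n ≤ M) (h1 : ∀ k, n ≤ k → k < M → c (k+1) = c k + s)
    (h2 : ∀ k, M ≤ k → k ≤ d → 0 < s * c k) : WCt c d ≤ WCt c n + 2 := by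
  classical
  have hs2 : 0 < s * s := mul_self_pos.2 hs
  have hsub : (range d).filter (Vv c) ⊆ (range n).filter (Vv c) ∪ ((Ico n M).filter (Vv c)) := by
    intro k hk
    simp only [Finset.mem_filter, Finset.mem_range, Finset.mem_union, Finset.mem_Ico] at *
    by_cases hn : k < n
    · left; exact ⟨hn, hk.2⟩
    right
    refine ⟨⟨by omega, ?_⟩, hk.2⟩
    by_contra hM
    have a1 := h2 k (by omega) (by omega)
    have a2 := h2 (k+1) (by omega) (by omega)
    have := hk.2.2
    have a3 := mul_pos a1 a2
    nlinarith
  refine (Finset.card_le_card hsub).trans ((Finset.card_union_le _ _).trans ?_)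
  gcongr
  · rfl
  rcases ((Ico n M).filter (Vv c)).eq_empty_or_nonempty with he | hne
  · rw [he]; simp
  set k1 := ((Ico n M).filter (Vv c)).min' hne with hk1
  have hk1m := Finset.min'_mem _ hne
  rw [← hk1] at hk1m
  have hmono : ∀ k l, n ≤ k → k ≤ l → l ≤ M → s * c k + (l - k : ℝ) * (s * s) = s * c l := by
    intro k l hk hkl hl
    induction l, hkl using Nat.le_induction with
    | base => ring
    | succ l hkl ih =>
      rw [h1 l (by omega) (by omega), mul_add, ← ih (by omega)]; push_cast; ring
  have hev : ∀ k, k ∈ (Ico n M).filter (Vv c) → s * c k ≤ 0 ∧ 0 ≤ s * c (k+1) := by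
    intro k hk
    simp only [Finset.mem_filter, Finset.mem_Ico] at hk
    have e := h1 k hk.1.1 hk.1.2
    have hp := hk.2.2
    have hp2 : (s * c k) * (s * c (k+1)) ≤ 0 := by nlinarith
    have e2 : s * c (k+1) = s * c k + s * s := by rw [e]; ring
    constructor
    · by_contra hh; push Not at hh
      have : 0 < s * c (k+1) := by linarith
      nlinarith
    · by_contra hh; push Not at hh
      have : s * c k < 0 := by linarith
      nlinarith
  have hsub2 : (Ico n M).filter (Vv c) ⊆ {k1, k1 + 1} := by
    intro k hk
    have hle : k1 ≤ k := Finset.min'_le _ _ hk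
    have b1 := (hev k hk).1
    have b2 := (hev k1 hk1m).2
    simp only [Finset.mem_filter, Finset.mem_Ico] at hk hk1m
    by_contra hcon
    simp only [Finset.mem_insert, Finset.mem_singleton] at hcon
    push Not at hcon
    have hlt : k1 + 2 ≤ k := by omega
    have hm := hmono (k1+1) k (by omega) (by omega) (by omega)
    have : (1:ℝ) ≤ k - ((k1 + 1 : ℕ) : ℝ) := by
      have : ((k1 + 2 : ℕ) : ℝ) ≤ k := by exact_mod_cast hlt
      push_cast at *; linarith
    nlinarith
  exact (Finset.card_le_card hsub2).trans Finset.card_le_two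

lemma pS_stable (P : ℝ[X]) (n : ℕ) (hd : P.natDegree ≤ n) (k : ℕ) (hk : n ≤ k) : pS P.coeff k = P.eval 1 := by
  rw [eval_eq_sum_range' (n := k+1) (by omega)]
  simp [pS]

lemma lemH (P : ℝ[X]) (n : ℕ) (hd : P.natDegree ≤ n) (h1 : P.eval 1 ≠ 0) :
    ∃ M0 : ℕ, ∀ M ≥ M0, WCt (pS (P * geom M).coeff) (n+M) ≤ WCt (pT P.coeff) n + 2 := by
  set s := P.eval 1 with hs
  set A := ∑ i ∈ range (n+1), |P.coeff i| with hA
  obtain ⟨M1, hM1⟩ := exists_nat_gt ((|s| * |pT P.coeff n| + |s| * (n * A)) / (s * s))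
  have hs2 : 0 < s * s := mul_self_pos.2 h1
  refine ⟨n + M1, fun M hM => ?_⟩
  have hc : ∀ k ≤ M, pS (P * geom M).coeff k = pT P.coeff k := by
    intro k hk
    unfold pT
    rw [pS]
    refine Finset.sum_congr rfl fun j hj => ?_
    rw [Finset.mem_range] at hj
    exact mul_geom_coeff_le P (by omega)
  have hlin : ∀ k, n ≤ k → k < M → pS (P * geom M).coeff (k+1) = pS (P * geom M).coeff k + s := by
    intro k hk hkM
    rw [hc _ (by omega), hc _ (by omega), pT_succ, pS_stable P n hd _ (by omega)]
  have hlin2 : ∀ k, n ≤ k → k ≤ M → pS (P * geom M).coeff k = pT P.coeff n + ((k:ℝ) - n) * s := by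
    intro k hk hkM
    induction k, hk using Nat.le_induction with
    | base => rw [hc _ hkM]; ring
    | succ k hk ih => rw [hlin k hk (by omega), ih (by omega)]; push_cast; ring
  have hA0 : 0 ≤ A := Finset.sum_nonneg fun i _ => abs_nonneg _
  have hdev : ∀ i : ℕ, |pS (P * geom M).coeff (M+i) - pS (P * geom M).coeff M| ≤ i * A := by
    intro i
    induction i with
    | zero => simp
    | succ i ih =>
      rw [← add_assoc, pS_succ, add_sub_right_comm]
      refine (abs_add_le _ _).trans ?_
      have := mul_geom_abs P n M (M+i+1) hd
      push_cast
      linarith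
  have hfin : ∀ k, M ≤ k → k ≤ n + M → 0 < s * pS (P * geom M).coeff k := by
    intro k hk hkd
    obtain ⟨i, rfl⟩ := Nat.exists_eq_add_of_le hk
    have hi : (i:ℝ) ≤ n := by exact_mod_cast (by omega : i ≤ n)
    have hd' := hdev i
    rw [hlin2 M (by omega) le_rfl] at hd'
    set c := pS (P * geom M).coeff (M+i)
    have e : s * c = s * (c - (pT P.coeff n + ((M:ℝ) - n) * s)) + s * pT P.coeff n + ((M:ℝ) - n) * (s * s) := by ring
    have b1 := neg_abs_le (s * (c - (pT P.coeff n + ((M:ℝ) - n) * s)))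
    have b2 := neg_abs_le (s * pT P.coeff n)
    rw [abs_mul] at b1 b2
    have b3 : |s| * |c - (pT P.coeff n + ((M:ℝ) - n) * s)| ≤ |s| * (n * A) := by
      gcongr; exact hd'.trans (by gcongr)
    have b4 : (M1:ℝ) ≤ (M:ℝ) - n := by
      have : ((n + M1 : ℕ):ℝ) ≤ M := by exact_mod_cast hM
      push_cast at this; linarith
    rw [div_lt_iff₀ hs2] at hM1
    have b5 : (M1:ℝ) * (s * s) ≤ ((M:ℝ) - n) * (s * s) := by gcongr
    linarith
  have := lin_events _ s h1 n M (n+M) (by omega) hlin hfin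
  rwa [WCt_congr (c' := pT P.coeff) (D := n) (fun k hk => hc k (by omega))] at this

lemma case1 (P : ℝ[X]) (n : ℕ) (hd : P.natDegree ≤ n) (h1 : P.eval 1 ≠ 0) :
    posr P ≤ WCt (pT P.coeff) n + WCt (pT (reflect n P).coeff) n + 4 := by
  have hP : P ≠ 0 := by rintro rfl; simp at h1
  have hdr : (reflect n P).natDegree ≤ n := by
    rw [natDegree_le_iff_coeff_eq_zero]
    intro k hk
    rw [coeff_reflect, revAt_eq_self_of_lt hk, coeff_eq_zero_of_natDegree_lt (by omega)]
  have h1r : (reflect n P).eval 1 ≠ 0 := by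
    haveI : Invertible (1:ℝ) := invertibleOne
    have := eval₂_reflect_mul_pow (RingHom.id ℝ) 1 n P hd
    simp only [invOf_one, one_pow, mul_one] at this
    unfold eval at *
    rw [this]; exact h1
  obtain ⟨M0, hM0⟩ := lemH P n hd h1
  obtain ⟨M1, hM1⟩ := lemH _ n hdr h1r
  set M := max M0 M1
  have a1 := hM0 M (le_max_left _ _)
  have a2 := hM1 M (le_max_right _ _)
  have hg := lemG (P * geom M) (mul_ne_zero hP (geom_ne M)) (n+M) (natDegree_mul_le.trans (Nat.add_le_add hd (geom_natDegree M)))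
  rw [reflect_mul _ _ hd (geom_natDegree M), geom_reflect] at hg
  have := posr_mul_le hP (geom_ne M)
  omega

theorem posr_bound (P : ℝ[X]) (hP : P ≠ 0) (n : ℕ) (hn : 1 ≤ n) (hd : P.natDegree ≤ n) :
    posr P ≤ WCt (pT P.coeff) n + WCt (pT (reflect n P).coeff) n + 4 := by
  by_cases h : P.eval 1 = 0
  · have := case0 P hP n hn hd h; omega
  · exact case1 P n hd h

lemma WCt_EE (a : ℕ → ℝ) (n : ℕ) : (WCt (pT a) n : ℝ) = ∑ k ∈ range n, ind (EE a (k+1)) := by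
  classical
  unfold WCt
  rw [Finset.card_filter]
  push_cast
  refine Finset.sum_congr rfl fun k _ => ?_
  have : Vv (pT a) k ↔ EE a (k+1) := by
    unfold Vv EE
    rw [pT_succ]
    constructor
    · rintro ⟨h1, h2⟩
      refine ⟨fun h => h1 (by rw [h, add_zero]), ?_⟩
      linarith [h2]
    · rintro ⟨h1, h2⟩
      refine ⟨fun h => h1 (by linarith), ?_⟩
      linarith [h2]
  rw [← ind_congr this]
  unfold ind
  rfl

end descartes

open Finset Polynomial

section final
variable {n : ℕ}

noncomputable def RP (ε : ℝ) (u : Fin (n+1) → ℝ) (π : Equiv.Perm (Fin (n+1))) : ℝ[X] :=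
  ∑ k : Fin (n+1), C (sqn ε u π k) * X ^ (k:ℕ)

lemma RP_coeff (ε : ℝ) (u : Fin (n+1) → ℝ) (π : Equiv.Perm (Fin (n+1))) : (RP ε u π).coeff = sqn ε u π := by
  ext j
  unfold RP
  rw [Fin.sum_univ_eq_sum_range (fun k => C (sqn ε u π k) * X ^ k), finsetSum_coeff]
  simp only [coeff_C_mul_X_pow]
  rw [Finset.sum_ite_eq]
  split_ifs with h
  · rfl
  · unfold sqn; rw [dif_neg (by simpa using h)]

lemma RP_natDegree (ε : ℝ) (u : Fin (n+1) → ℝ) (π : Equiv.Perm (Fin (n+1))) : (RP ε u π).natDegree ≤ n := by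
  rw [natDegree_le_iff_coeff_eq_zero]
  intro k hk
  rw [RP_coeff]; unfold sqn; rw [dif_neg (by omega)]

lemma RP_ne (ε : ℝ) (hε : ε = 1 ∨ ε = -1) (u : Fin (n+1) → ℝ) (hu : u ≠ 0) (π : Equiv.Perm (Fin (n+1))) : RP ε u π ≠ 0 := by
  intro h
  apply hu
  funext i
  have h1 : (RP ε u π).coeff ((π.symm i : Fin (n+1)) : ℕ) = 0 := by rw [h]; simp
  rw [RP_coeff, sqn_lt] at h1
  have hε0 : ε ≠ 0 := by rcases hε with h | h <;> rw [h] <;> norm_num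
  simpa [hε0] using h1

lemma RP_comp (u : Fin (n+1) → ℝ) (π : Equiv.Perm (Fin (n+1))) : (RP 1 u π).comp (-X) = RP (-1) u π := by
  unfold RP
  rw [Polynomial.sum_comp]
  refine Finset.sum_congr rfl fun k _ => ?_
  rw [sqn_lt, sqn_lt, mul_comp, C_comp, X_pow_comp, neg_pow, one_pow, one_mul, C_mul, C_pow]
  simp only [map_neg, map_one]
  ring

lemma pS_smul (a : ℕ → ℝ) (c : ℝ) : pS (fun k => c * a k) = fun k => c * pS a k := by
  ext k; simp [pS, Finset.mul_sum]
lemma pT_smul (a : ℕ → ℝ) (c : ℝ) : pT (fun k => c * a k) = fun k => c * pT a k := by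
  ext k; simp only [pT, pS_smul, Finset.mul_sum]

lemma RP_reflect (ε : ℝ) (hε : ε = 1 ∨ ε = -1) (u : Fin (n+1) → ℝ) (π : Equiv.Perm (Fin (n+1))) :
    (reflect n (RP ε u π)).coeff = fun k => ε ^ n * sqn ε u (π * Fin.revPerm) k := by
  ext k
  rw [coeff_reflect, RP_coeff]
  rcases le_or_gt k n with h | h
  · rw [revAt_le h]
    have e1 := sqn_lt ε u (π * Fin.revPerm) ⟨k, by omega⟩
    have e2 := sqn_lt ε u π ⟨n - k, by omega⟩
    simp only at e1 e2
    rw [e1, e2, Equiv.Perm.mul_apply, Fin.revPerm_apply]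
    have e3 : Fin.rev (⟨k, by omega⟩ : Fin (n+1)) = ⟨n - k, by omega⟩ := by
      apply Fin.ext; simp [Fin.rev]
    rw [e3, ← mul_assoc]
    congr 1
    have e4 : n = (n - k) + k := by omega
    conv_rhs => rw [e4]
    rw [pow_add, mul_assoc, ← mul_pow]
    have : ε * ε = 1 := by rcases hε with h | h <;> rw [h] <;> norm_num
    rw [this]; simp
  · rw [revAt_eq_self_of_lt h]
    unfold sqn
    rw [dif_neg (by omega), dif_neg (by omega), mul_zero]

lemma WCt_pow (ε : ℝ) (hε : ε = 1 ∨ ε = -1) (a : ℕ → ℝ) (m : ℕ) : WCt (pT fun k => ε ^ m * a k) n = WCt (pT a) n := by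
  rw [pT_smul]
  have : ε ^ m = 1 ∨ ε ^ m = -1 := by
    rcases hε with h | h
    · left; simp [h]
    · rw [h]; exact neg_one_pow_eq_or ℝ m
  rcases this with h | h
  · rw [h]; simp
  · rw [h, ← WCt_neg (pT a)]; simp

lemma Ex_WCt (ε : ℝ) (hε : ε = 1 ∨ ε = -1) (u : Fin (n+1) → ℝ) :
    Ex (fun π => (WCt (pT (sqn ε u π)) n : ℝ)) ≤ 5000000000 * Real.log (n+1) := by
  simp only [WCt_EE]
  rw [Ex_sum]
  calc _ ≤ ∑ k ∈ range n, 5000000000 * (((k + 1 : ℕ) : ℝ) + 1)⁻¹ := by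
        apply Finset.sum_le_sum
        intro k hk
        rw [Finset.mem_range] at hk
        rw [← div_eq_mul_inv]
        exact prob_EE (by omega) (by omega) ε hε u
    _ = 5000000000 * ∑ k ∈ range n, (((k + 1 : ℕ) : ℝ) + 1)⁻¹ := by rw [Finset.mul_sum]
    _ ≤ _ := by
        gcongr
        have h := harmonic_le_one_add_log (n+1)
        unfold harmonic at h
        rw [Finset.sum_range_succ'] at h
        push_cast at h ⊢
        simp at h
        linarith

lemma Ex_posr (ε : ℝ) (hε : ε = 1 ∨ ε = -1) (hn : 1 ≤ n) (u : Fin (n+1) → ℝ) (hu : u ≠ 0) :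
    Ex (fun π => (posr (RP ε u π) : ℝ)) ≤ 10000000000 * Real.log (n+1) + 4 := by
  have h1 : ∀ π, (posr (RP ε u π) : ℝ) ≤ (WCt (pT (sqn ε u π)) n : ℝ) + (WCt (pT (sqn ε u (π * Fin.revPerm))) n : ℝ) + 4 := by
    intro π
    have := posr_bound (RP ε u π) (RP_ne ε hε u hu π) n hn (RP_natDegree ε u π)
    rw [RP_coeff, RP_reflect ε hε, WCt_pow ε hε] at this
    exact_mod_cast this
  refine (Ex_mono h1).trans ?_
  rw [Ex_add, Ex_add, Ex_const, Ex_mulRight Fin.revPerm (fun π => (WCt (pT (sqn ε u π)) n : ℝ))]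
  have := Ex_WCt ε hε u
  linarith

lemma nonzero_le (P : ℝ[X]) [DecidablePred fun x : ℝ => x ≠ 0] :
    (P.roots.filter (fun x => x ≠ 0)).card ≤ posr P + posr (P.comp (-X)) := by
  classical
  unfold posr
  rw [roots_comp_neg_X, Multiset.countP_map, ← Multiset.countP_eq_card_filter, ← Multiset.countP_eq_card_filter]
  generalize P.roots = s
  induction s using Multiset.induction with
  | empty => simp
  | cons a s ih =>
    simp only [Multiset.countP_cons]
    have : (if a ≠ 0 then 1 else 0) ≤ (if 0 < a then 1 else 0) + (if 0 < -a then 1 else 0) := by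
      rcases lt_trichotomy a 0 with h | h | h
      · simp [h.ne, h]
      · simp [h]
      · simp [h.ne', h]
    omega

end final

open scoped Classical in
theorem stmt_0 :
    ∃ C > (0:ℝ), ∀ (n : ℕ), 2 ≤ n → ∀ u : Fin (n+1) → ℝ, u ≠ 0 →
      (∑ π : Equiv.Perm (Fin (n+1)),
          (((∑ k : Fin (n+1), Polynomial.C (u (π k)) * Polynomial.X ^ (k:ℕ)).roots.filter
              (fun x => x ≠ 0)).card : ℝ)) / ((n+1).factorial : ℝ)
        ≤ C * Real.log n := by
  refine ⟨50000000000, by norm_num, fun n hn u hu => ?_⟩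
  have hEx : (∑ π : Equiv.Perm (Fin (n+1)),
          (((∑ k : Fin (n+1), Polynomial.C (u (π k)) * Polynomial.X ^ (k:ℕ)).roots.filter
              (fun x => x ≠ 0)).card : ℝ)) / ((n+1).factorial : ℝ) =
      Ex (fun π : Equiv.Perm (Fin (n+1)) => (((RP 1 u π).roots.filter (fun x => x ≠ 0)).card : ℝ)) := by
    unfold Ex
    rw [Fintype.card_perm, Fintype.card_fin]
    congr 1
    refine Finset.sum_congr rfl fun π _ => ?_
    unfold RP
    simp only [sqn_lt, one_pow, one_mul]
  rw [hEx]
  have h1 : ∀ π, (((RP 1 u π).roots.filter (fun x => x ≠ 0)).card : ℝ) ≤ (posr (RP 1 u π) : ℝ) + (posr (RP (-1) u π) : ℝ) := by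
    intro π
    have := nonzero_le (RP 1 u π)
    rw [RP_comp] at this
    exact_mod_cast this
  refine (Ex_mono h1).trans ?_
  rw [Ex_add]
  have a1 := Ex_posr 1 (Or.inl rfl) (by omega : 1 ≤ n) u hu
  have a2 := Ex_posr (-1) (Or.inr rfl) (by omega : 1 ≤ n) u hu
  have hn' : (2:ℝ) ≤ n := by exact_mod_cast hn
  have hlog : Real.log (n+1) ≤ 2 * Real.log n := by
    have : Real.log (n+1) ≤ Real.log ((n:ℝ)^2) := Real.log_le_log (by positivity) (by nlinarith)
    rwa [Real.log_pow, Nat.cast_ofNat] at this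
  have hl2 : Real.log 2 ≤ Real.log n := Real.log_le_log (by norm_num) hn'
  have := Real.log_two_gt_d9
  linarith
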